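/- arXiv:1003.2792 — 3 statements merged into one kernel-verified Lean document; each statement's English description precedes it below -/
import Mathlib

section
/- Let G₁ = PGL₂(q) where 3 < q = p^e for an odd prime p and a positive integer e. If G₁ admits an unmixed Beauville structure of type ((r₁,s₁,t₁),(r₂,s₂,t₂)), then each of the nine integers gcd(r₁,r₂), gcd(r₁,s₂), gcd(r₁,t₂), gcd(s₁,r₂), gcd(s₁,s₂), gcd(s₁,t₂), gcd(t₁,r₂), gcd(t₁,s₂), gcd(t₁,t₂) is equal to 1 or 2. -/
open Matrix

/-- The projective general linear group `PGL₂(F) = GL(2, F) / Z(GL(2, F))`. -/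
abbrev PGL2 (F : Type*) [Field F] :=
  Matrix.GeneralLinearGroup (Fin 2) F ⧸ Subgroup.center (Matrix.GeneralLinearGroup (Fin 2) F)

/-- `Σ(a)`: the union of the conjugacy classes of all powers of `a`. -/
def conjPowers {G : Type*} [Group G] (a : G) : Set G :=
  {x | ∃ (g : G) (j : ℕ), x = g * a ^ j * g⁻¹}

/-- `Σ(a, b, c)`: the union of the conjugacy classes of all powers of `a`, of `b`, and
of `c`. -/
def sigma3 {G : Type*} [Group G] (a b c : G) : Set G :=
  conjPowers a ∪ conjPowers b ∪ conjPowers c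

/-- An unmixed Beauville structure for a group `G`: two triples, each with product `1` and
generating `G`, whose `Σ`-sets intersect trivially. -/
def IsUnmixedBeauville {G : Type*} [Group G] (a₁ b₁ c₁ a₂ b₂ c₂ : G) : Prop :=
  a₁ * b₁ * c₁ = 1 ∧ a₂ * b₂ * c₂ = 1 ∧
  Subgroup.closure ({a₁, b₁} : Set G) = ⊤ ∧ Subgroup.closure ({a₂, b₂} : Set G) = ⊤ ∧
  sigma3 a₁ b₁ c₁ ∩ sigma3 a₂ b₂ c₂ = {1}

/-- `G` admits an unmixed Beauville structure of type `((r₁,s₁,t₁),(r₂,s₂,t₂))`. -/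
def HasBeauvilleOfType (G : Type*) [Group G] (r₁ s₁ t₁ r₂ s₂ t₂ : ℕ) : Prop :=
  ∃ a₁ b₁ c₁ a₂ b₂ c₂ : G, IsUnmixedBeauville a₁ b₁ c₁ a₂ b₂ c₂ ∧
    orderOf a₁ = r₁ ∧ orderOf b₁ = s₁ ∧ orderOf c₁ = t₁ ∧
    orderOf a₂ = r₂ ∧ orderOf b₂ = s₂ ∧ orderOf c₂ = t₂

namespace PGL2

variable {F : Type*} [Field F]

lemma mk_eq_one_iff (A : GL (Fin 2) F) :
    (A : PGL2 F) = 1 ↔ A.val ∈ Set.range (Matrix.scalar (Fin 2)) := by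
  rw [QuotientGroup.eq_one_iff, GeneralLinearGroup.mem_center_iff_val_mem_range_scalar]

lemma mem_range_scalar_iff (A : Matrix (Fin 2) (Fin 2) F) :
    A ∈ Set.range (Matrix.scalar (Fin 2)) ↔ A 0 1 = 0 ∧ A 1 0 = 0 ∧ A 0 0 = A 1 1 := by
  constructor
  · rintro ⟨a, rfl⟩
    simp
  · rintro ⟨h₁, h₂, h₃⟩
    refine ⟨A 0 0, ?_⟩
    ext i j
    fin_cases i <;> fin_cases j <;> simp [h₁, h₂, h₃]

/-- A non-scalar `2 × 2` matrix is conjugate to the companion matrix of its characteristic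
polynomial. -/
lemma exists_mul_eq_mul_companion {A : Matrix (Fin 2) (Fin 2) F}
    (hA : A ∉ Set.range (Matrix.scalar (Fin 2))) :
    ∃ P : GL (Fin 2) F, A * P.val = P.val * !![0, -A.det; 1, A.trace] := by
  have key (x y : F) (h : x * (A 1 0 * x + A 1 1 * y) - (A 0 0 * x + A 0 1 * y) * y ≠ 0) :
      ∃ P : GL (Fin 2) F, A * P.val = P.val * !![0, -A.det; 1, A.trace] := by
    refine ⟨GeneralLinearGroup.mkOfDetNeZero
      !![x, A 0 0 * x + A 0 1 * y; y, A 1 0 * x + A 1 1 * y] ?_, ?_⟩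
    · rwa [det_fin_two_of]
    · simp only [GeneralLinearGroup.mkOfDetNeZero, det_fin_two, trace_fin_two]
      ext i j
      fin_cases i <;> fin_cases j <;>
        simp [GeneralLinearGroup.mk', unitOfDetInvertible, Matrix.mul_apply] <;> ring
  rw [mem_range_scalar_iff] at hA
  by_cases h₁ : A 1 0 = 0
  · by_cases h₂ : A 0 1 = 0
    · refine key 1 1 fun h ↦ hA ⟨h₂, h₁, ?_⟩
      rw [h₁, h₂] at h
      linear_combination -h
    · exact key 0 1 (by simpa using h₂)
  · exact key 1 0 (by simpa using h₁)

lemma isConj_of_trace_eq_of_det_eq {A B : GL (Fin 2) F}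
    (hA : A.val ∉ Set.range (Matrix.scalar (Fin 2)))
    (hB : B.val ∉ Set.range (Matrix.scalar (Fin 2)))
    (ht : A.val.trace = B.val.trace) (hd : A.val.det = B.val.det) : IsConj A B := by
  obtain ⟨P, hP⟩ := exists_mul_eq_mul_companion hA
  obtain ⟨Q, hQ⟩ := exists_mul_eq_mul_companion hB
  rw [ht, hd] at hP
  rw [isConj_iff]
  refine ⟨Q * P⁻¹, ?_⟩
  have h : P⁻¹ * A * P = Q⁻¹ * B * Q := by
    apply Units.ext
    simp only [Units.val_mul, mul_assoc, hP, hQ, Units.inv_mul_cancel_left]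
  calc Q * P⁻¹ * A * (Q * P⁻¹)⁻¹ = Q * (P⁻¹ * A * P) * Q⁻¹ := by group
    _ = B := by rw [h]; group

/-- The conjugacy class of a nontrivial element of `PGL₂(F)` of nonzero trace is determined by
`trace ^ 2 / det`. -/
lemma isConj_mk_of_trace_sq_mul_det_eq {A B : GL (Fin 2) F}
    (hA : (A : PGL2 F) ≠ 1) (hB : (B : PGL2 F) ≠ 1) (hB₀ : B.val.trace ≠ 0)
    (h : A.val.trace ^ 2 * B.val.det = B.val.trace ^ 2 * A.val.det) :
    IsConj (A : PGL2 F) (B : PGL2 F) := by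
  have hdA : A.val.det ≠ 0 := GeneralLinearGroup.det_ne_zero A
  have hA₀ : A.val.trace ≠ 0 := by
    intro h₀
    rw [h₀] at h
    have : B.val.trace ^ 2 * A.val.det ≠ 0 := mul_ne_zero (pow_ne_zero _ hB₀) hdA
    simp [← h] at this
  have hc : A.val.trace / B.val.trace ≠ 0 := div_ne_zero hA₀ hB₀
  set c := Units.mk0 _ hc
  have hz : GeneralLinearGroup.scalar (Fin 2) c ∈ Subgroup.center (GL (Fin 2) F) := by
    rw [GeneralLinearGroup.center_eq_range_scalar]
    exact ⟨c, rfl⟩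
  have hmk : ((GeneralLinearGroup.scalar (Fin 2) c * B : GL (Fin 2) F) : PGL2 F) = B := by
    rw [QuotientGroup.mk_mul, (QuotientGroup.eq_one_iff _).2 hz, one_mul]
  have hcv : (c : F) = A.val.trace / B.val.trace := rfl
  have hval : (GeneralLinearGroup.scalar (Fin 2) c * B).val = (c : F) • B.val := by
    simp [← smul_eq_diagonal_mul]
  rw [← hmk] at hB ⊢
  refine MonoidHom.map_isConj (QuotientGroup.mk' _) (isConj_of_trace_eq_of_det_eq
    (mt (mk_eq_one_iff A).2 hA) (mt (mk_eq_one_iff _).2 hB) ?_ ?_)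
  · rw [hval, trace_smul, hcv, smul_eq_mul, div_mul_cancel₀ _ hB₀]
  · rw [hval, det_smul, hcv, Fintype.card_fin, div_pow, div_mul_eq_mul_div,
      eq_div_iff (pow_ne_zero _ hB₀), h, mul_comm]

lemma sq_eq_trace_smul_sub (A : Matrix (Fin 2) (Fin 2) F) :
    A * A = A.trace • A - A.det • (1 : Matrix (Fin 2) (Fin 2) F) := by
  ext i j
  fin_cases i <;> fin_cases j <;>
    simp [Matrix.mul_apply, trace_fin_two, det_fin_two] <;> ring

lemma smul_add_smul_one_mem_range_scalar_iff {A : Matrix (Fin 2) (Fin 2) F}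
    (hA : A ∉ Set.range (Matrix.scalar (Fin 2))) (u s : F) :
    u • A + s • (1 : Matrix (Fin 2) (Fin 2) F) ∈ Set.range (Matrix.scalar (Fin 2)) ↔ u = 0 := by
  rw [mem_range_scalar_iff] at hA ⊢
  constructor
  · intro h
    by_contra hu
    simp [hu] at h
    tauto
  · rintro rfl
    simp

lemma mk_pow_two_eq_one_of_trace_eq_zero {A : GL (Fin 2) F} (h : A.val.trace = 0) :
    (A : PGL2 F) ^ 2 = 1 := by
  rw [← QuotientGroup.mk_pow, mk_eq_one_iff, Units.val_pow_eq_pow_val, pow_two,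
    sq_eq_trace_smul_sub, h]
  refine ⟨-A.val.det, ?_⟩
  ext i j
  fin_cases i <;> fin_cases j <;> simp

variable {K : Type*} [Field K] [Algebra F K]

/-- `l` and `m` are the eigenvalues of `A` in an extension field. -/
structure IsEigenPair (A : Matrix (Fin 2) (Fin 2) F) (l m : K) : Prop where
  add_eq : l + m = algebraMap F K A.trace
  mul_eq : l * m = algebraMap F K A.det

lemma exists_isEigenPair [IsAlgClosed K] (A : Matrix (Fin 2) (Fin 2) F) :
    ∃ l m : K, IsEigenPair A l m := by
  obtain ⟨l, hl⟩ := IsAlgClosed.exists_root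
    (Polynomial.X ^ 2 - Polynomial.C (algebraMap F K A.trace) * Polynomial.X
      + Polynomial.C (algebraMap F K A.det)) (by
      have : (Polynomial.X ^ 2 - Polynomial.C (algebraMap F K A.trace) * Polynomial.X
        + Polynomial.C (algebraMap F K A.det)).degree = 2 := by compute_degree!
      rw [this]
      norm_num)
  simp only [Polynomial.IsRoot, Polynomial.eval_add, Polynomial.eval_sub, Polynomial.eval_mul,
    Polynomial.eval_pow, Polynomial.eval_X, Polynomial.eval_C] at hl
  exact ⟨l, algebraMap F K A.trace - l, by ring, by linear_combination -hl⟩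

namespace IsEigenPair

lemma exists_pow_eq {A : Matrix (Fin 2) (Fin 2) F} {l m : K} (h : IsEigenPair A l m) (j : ℕ) :
    ∃ u s : F, A ^ j = u • A + s • (1 : Matrix (Fin 2) (Fin 2) F) ∧
      l ^ j = algebraMap F K u * l + algebraMap F K s ∧
      m ^ j = algebraMap F K u * m + algebraMap F K s ∧
      (l = m → l * algebraMap F K u = j * l ^ j) := by
  induction j with
  | zero => exact ⟨0, 1, by simp, by simp, by simp, by simp⟩
  | succ j ih =>
    obtain ⟨u, s, hA, hl, hm, hlm⟩ := ih
    refine ⟨u * A.trace + s, -(u * A.det), ?_, ?_, ?_, ?_⟩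
    · rw [pow_succ, hA, add_mul, smul_mul_assoc, smul_mul_assoc, sq_eq_trace_smul_sub, one_mul]
      module
    · rw [pow_succ, hl]
      simp only [map_add, map_mul, map_neg, ← h.add_eq, ← h.mul_eq]
      ring
    · rw [pow_succ, hm]
      simp only [map_add, map_mul, map_neg, ← h.add_eq, ← h.mul_eq]
      ring
    · intro e
      have := hlm e
      subst e
      simp only [map_add, map_mul, ← h.add_eq]
      push_cast
      linear_combination l * this - l * hl

lemma pow {A : Matrix (Fin 2) (Fin 2) F} {l m : K} (h : IsEigenPair A l m) (j : ℕ) :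
    IsEigenPair (A ^ j) (l ^ j) (m ^ j) where
  add_eq := by
    obtain ⟨u, s, hA, hl, hm, -⟩ := h.exists_pow_eq j
    rw [hA, hl, hm]
    simp only [trace_add, trace_smul, trace_one, Fintype.card_fin, smul_eq_mul, map_add, map_mul,
      ← h.add_eq]
    rw [Nat.cast_ofNat, map_ofNat]
    ring
  mul_eq := by rw [det_pow, map_pow, ← h.mul_eq, mul_pow]

variable {A : GL (Fin 2) F} {l m : K}

lemma left_ne_zero (h : IsEigenPair A.val l m) : l ≠ 0 := by
  rintro rfl
  have := h.mul_eq
  rw [zero_mul, eq_comm, map_eq_zero] at this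
  exact GeneralLinearGroup.det_ne_zero A this

lemma right_ne_zero (h : IsEigenPair A.val l m) : m ≠ 0 := by
  rintro rfl
  have := h.mul_eq
  rw [mul_zero, eq_comm, map_eq_zero] at this
  exact GeneralLinearGroup.det_ne_zero A this

lemma mk_pow_eq_one_iff_natCast_eq_zero (h : IsEigenPair A.val l m) (hA : (A : PGL2 F) ≠ 1)
    (hlm : l = m) (j : ℕ) : (A : PGL2 F) ^ j = 1 ↔ (j : K) = 0 := by
  obtain ⟨u, s, hAj, -, -, hu⟩ := h.exists_pow_eq j
  rw [← QuotientGroup.mk_pow, mk_eq_one_iff, Units.val_pow_eq_pow_val, hAj,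
    smul_add_smul_one_mem_range_scalar_iff (mt (mk_eq_one_iff A).2 hA),
    ← map_eq_zero (algebraMap F K), ← mul_eq_zero_iff_left h.left_ne_zero, hu hlm,
    mul_eq_zero_iff_right (pow_ne_zero _ h.left_ne_zero)]

lemma mk_pow_eq_one_iff_div_pow_eq_one (h : IsEigenPair A.val l m) (hA : (A : PGL2 F) ≠ 1)
    (hlm : l ≠ m) (j : ℕ) : (A : PGL2 F) ^ j = 1 ↔ (l / m) ^ j = 1 := by
  obtain ⟨u, s, hAj, hl, hm, -⟩ := h.exists_pow_eq j
  rw [← QuotientGroup.mk_pow, mk_eq_one_iff, Units.val_pow_eq_pow_val, hAj,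
    smul_add_smul_one_mem_range_scalar_iff (mt (mk_eq_one_iff A).2 hA), div_pow,
    div_eq_one_iff_eq (pow_ne_zero _ h.right_ne_zero), hl, hm, add_left_inj,
    ← map_eq_zero (algebraMap F K)]
  constructor
  · intro h₀
    simp [h₀]
  · intro h₀
    by_contra hu
    exact hlm (mul_left_cancel₀ hu h₀)

/-- Matrices whose eigenvalues have the same quotient have the same `trace ^ 2 / det`. -/
lemma trace_sq_mul_det_eq {B : GL (Fin 2) F} {l' m' : K} (h : IsEigenPair A.val l m)
    (h' : IsEigenPair B.val l' m') (e : l / m = l' / m') :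
    A.val.trace ^ 2 * B.val.det = B.val.trace ^ 2 * A.val.det := by
  apply (algebraMap F K).injective
  rw [div_eq_div_iff h.right_ne_zero h'.right_ne_zero] at e
  simp only [map_mul, map_pow, ← h.add_eq, ← h.mul_eq, ← h'.add_eq, ← h'.mul_eq]
  linear_combination (l * l' - m * m') * e

end IsEigenPair

/-- In `PGL₂` over a finite field, cyclic subgroups of the same order at least `3` are
conjugate. -/
lemma exists_isConj_pow [Finite F] {x y : PGL2 F} {n : ℕ} (hn : 3 ≤ n)
    (hx : orderOf x = n) (hy : orderOf y = n) : ∃ j : ℕ, IsConj (x ^ j) y := by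
  obtain ⟨A, rfl⟩ := QuotientGroup.mk_surjective x
  obtain ⟨B, rfl⟩ := QuotientGroup.mk_surjective y
  have hA : (A : PGL2 F) ≠ 1 := fun h ↦ by rw [h, orderOf_one] at hx; omega
  have hB : (B : PGL2 F) ≠ 1 := fun h ↦ by rw [h, orderOf_one] at hy; omega
  have hB₀ : B.val.trace ≠ 0 := fun h ↦ by
    have := orderOf_le_of_pow_eq_one two_pos (mk_pow_two_eq_one_of_trace_eq_zero h)
    omega
  obtain ⟨l, m, h⟩ := exists_isEigenPair (K := AlgebraicClosure F) A.val
  obtain ⟨l', m', h'⟩ := exists_isEigenPair (K := AlgebraicClosure F) B.val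
  have not_mixed {C D : GL (Fin 2) F} {a b c d : AlgebraicClosure F}
      (hC : (C : PGL2 F) ≠ 1) (hD : (D : PGL2 F) ≠ 1)
      (hCD : orderOf (C : PGL2 F) = orderOf (D : PGL2 F))
      (h₁ : IsEigenPair C.val a b) (h₂ : IsEigenPair D.val c d) (hab : a = b) : c = d := by
    by_contra hcd
    obtain ⟨p, hp⟩ := CharP.exists (AlgebraicClosure F)
    have : CharP F p := (algebraMap F (AlgebraicClosure F)).charP_iff_charP p |>.2 hp
    have : Fact p.Prime := ⟨CharP.char_is_prime F p⟩
    have hpC := (h₁.mk_pow_eq_one_iff_natCast_eq_zero hC hab p).2 (CharP.cast_eq_zero _ p)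
    have hpD : (D : PGL2 F) ^ p = 1 := by
      rw [← orderOf_dvd_iff_pow_eq_one, ← hCD]
      exact orderOf_dvd_of_pow_eq_one hpC
    rw [h₂.mk_pow_eq_one_iff_div_pow_eq_one hD hcd] at hpD
    have : (c / d - 1) ^ p = 0 := by rw [sub_pow_char, hpD, one_pow, sub_self]
    exact hcd ((div_eq_one_iff_eq h₂.right_ne_zero).1 (sub_eq_zero.1
      (eq_zero_of_pow_eq_zero this)))
  by_cases hlm : l = m
  · have hlm' := not_mixed hA hB (hx.trans hy.symm) h h' hlm
    refine ⟨1, ?_⟩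
    rw [pow_one]
    refine isConj_mk_of_trace_sq_mul_det_eq hA hB hB₀ (h.trace_sq_mul_det_eq h' ?_)
    rw [hlm, hlm', div_self h.right_ne_zero, div_self h'.right_ne_zero]
  · have hlm' : l' ≠ m' := fun e ↦ hlm (not_mixed hB hA (hy.trans hx.symm) h' h e)
    have hz : orderOf (l / m) = n := by
      rw [← hx, orderOf_eq_orderOf_iff]
      exact fun j ↦ (h.mk_pow_eq_one_iff_div_pow_eq_one hA hlm j).symm
    have : NeZero n := ⟨by omega⟩
    have hprim : IsPrimitiveRoot (l / m) n := hz ▸ IsPrimitiveRoot.orderOf _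
    have hz' : (l' / m') ^ n = 1 := by
      rw [← h'.mk_pow_eq_one_iff_div_pow_eq_one hB hlm', ← hy, pow_orderOf_eq_one]
    obtain ⟨j, -, hj⟩ := hprim.eq_pow_of_pow_eq_one hz'
    have hAj : ((A ^ j : GL (Fin 2) F) : PGL2 F) ≠ 1 := by
      rw [QuotientGroup.mk_pow, Ne, h.mk_pow_eq_one_iff_div_pow_eq_one hA hlm, hj,
        div_eq_one_iff_eq h'.right_ne_zero]
      exact hlm'
    have hpow : IsEigenPair (A ^ j).val (l ^ j) (m ^ j) := by
      rw [Units.val_pow_eq_pow_val]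
      exact h.pow j
    refine ⟨j, ?_⟩
    rw [← QuotientGroup.mk_pow]
    exact isConj_mk_of_trace_sq_mul_det_eq hAj hB hB₀
      (hpow.trace_sq_mul_det_eq h' (by rw [← div_pow, hj]))

/-- Two elements of `PGL₂` over a finite field none of whose nontrivial powers are conjugate have
orders with greatest common divisor at most `2`. -/
lemma gcd_orderOf_eq_one_or_two [Finite F] {x y : PGL2 F}
    (h : conjPowers x ∩ conjPowers y ⊆ {1}) :
    Nat.gcd (orderOf x) (orderOf y) = 1 ∨ Nat.gcd (orderOf x) (orderOf y) = 2 := by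
  have hx := orderOf_pos x
  have hy := orderOf_pos y
  set n := Nat.gcd (orderOf x) (orderOf y) with hn
  have hpos : 0 < n := Nat.gcd_pos_of_pos_left _ hx
  by_contra! hne
  have h3 : 3 ≤ n := by omega
  have hxn : orderOf (x ^ (orderOf x / n)) = n :=
    orderOf_pow_orderOf_div hx.ne' (Nat.gcd_dvd_left _ _)
  have hyn : orderOf (y ^ (orderOf y / n)) = n :=
    orderOf_pow_orderOf_div hy.ne' (Nat.gcd_dvd_right _ _)
  obtain ⟨j, hj⟩ := exists_isConj_pow h3 hxn hyn
  obtain ⟨g, hg⟩ := isConj_iff.1 hj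
  have hone : y ^ (orderOf y / n) = 1 :=
    h ⟨⟨g, orderOf x / n * j, by rw [pow_mul, hg]⟩, ⟨1, orderOf y / n, by simp⟩⟩
  rw [hone, orderOf_one] at hyn
  omega

end PGL2

/-- Let `G₁ = PGL₂(q)` with `3 < q = p ^ e`, `p` an odd prime.  If `G₁`
admits an unmixed Beauville structure of type `((r₁,s₁,t₁),(r₂,s₂,t₂))`, then each of the
nine pairwise gcds between the entries of the two triples is `1` or `2`. -/
theorem gcd_le_two_of_beauville_type_PGL2 (p e : ℕ) (hp : p.Prime) (hodd : Odd p)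
    (he : 0 < e) (hq : 3 < p ^ e)
    (F : Type*) [Field F] [Fintype F] (hF : Fintype.card F = p ^ e)
    (r₁ s₁ t₁ r₂ s₂ t₂ : ℕ)
    (h : HasBeauvilleOfType (PGL2 F) r₁ s₁ t₁ r₂ s₂ t₂) :
    ∀ m₁ ∈ [r₁, s₁, t₁], ∀ m₂ ∈ [r₂, s₂, t₂],
      Nat.gcd m₁ m₂ = 1 ∨ Nat.gcd m₁ m₂ = 2 := by
  have : Finite F := Finite.of_fintype F
  obtain ⟨a₁, b₁, c₁, a₂, b₂, c₂, ⟨-, -, -, -, h_inter⟩, rfl, rfl, rfl, rfl, rfl, rfl⟩ := h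
  have key (x y : PGL2 F) (hx : conjPowers x ⊆ sigma3 a₁ b₁ c₁)
      (hy : conjPowers y ⊆ sigma3 a₂ b₂ c₂) :
      Nat.gcd (orderOf x) (orderOf y) = 1 ∨ Nat.gcd (orderOf x) (orderOf y) = 2 :=
    PGL2.gcd_orderOf_eq_one_or_two (h_inter ▸ Set.inter_subset_inter hx hy)
  have ha {G : Type _} [Group G] (a b c : G) : conjPowers a ⊆ sigma3 a b c :=
    fun _ h ↦ Or.inl (Or.inl h)
  have hb {G : Type _} [Group G] (a b c : G) : conjPowers b ⊆ sigma3 a b c :=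
    fun _ h ↦ Or.inl (Or.inr h)
  have hc {G : Type _} [Group G] (a b c : G) : conjPowers c ⊆ sigma3 a b c :=
    fun _ h ↦ Or.inr h
  simp only [List.mem_cons, List.not_mem_nil, or_false]
  rintro _ (rfl | rfl | rfl) _ (rfl | rfl | rfl) <;> apply key <;>
    first | apply ha | apply hb | apply hc
end

section
/- Let G₁ = PGL₂(q) where 3 < q = p^e for an odd prime p and a positive integer e. If G₁ admits an unmixed Beauville structure of type ((r₁,s₁,t₁),(r₂,s₂,t₂)), then either every even integer among r₁, s₁, t₁ divides q−1 and every even integer among r₂, s₂, t₂ divides q+1, or every even integer among r₁, s₁, t₁ divides q+1 and every even integer among r₂, s₂, t₂ divides q−1. -/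
open Matrix

section MatrixTwo

variable {F : Type*} [Field F]

lemma mul_self_eq_of_trace_eq_zero {N : Matrix (Fin 2) (Fin 2) F} (hN : N.trace = 0) :
    N * N = (-N.det) • (1 : Matrix (Fin 2) (Fin 2) F) := by
  rw [trace_fin_two] at hN
  obtain rfl | h := eq_or_ne N 0
  · simp
  have h1 : N 1 1 = -N 0 0 := by linear_combination hN
  ext i j
  fin_cases i <;> fin_cases j <;> simp [mul_apply, det_fin_two, h1] <;> ring

/-- By Cayley–Hamilton, a non-scalar matrix with scalar square is traceless. -/
lemma trace_eq_zero_of_mul_self {N : Matrix (Fin 2) (Fin 2) F} {c : F}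
    (hN : N * N = c • (1 : Matrix (Fin 2) (Fin 2) F))
    (hns : ∀ d : F, N ≠ d • (1 : Matrix (Fin 2) (Fin 2) F)) : N.trace = 0 := by
  by_contra ht
  have hCH : N.trace • N = (c + N.det) • (1 : Matrix (Fin 2) (Fin 2) F) := by
    rw [add_smul, ← hN]
    ext i j
    fin_cases i <;> fin_cases j <;> simp [mul_apply, det_fin_two, trace_fin_two] <;> ring
  refine hns (N.trace⁻¹ * (c + N.det)) ?_
  rw [mul_smul, ← hCH, smul_smul, inv_mul_cancel₀ ht, one_smul]

/-- The centralizer of a nonzero traceless matrix `N` consists of the combinations of `1`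
and `N`. -/
lemma exists_eq_smul_one_add_smul_of_commute (h2 : (2 : F) ≠ 0)
    {M N : Matrix (Fin 2) (Fin 2) F} (hN : N.trace = 0) (hN0 : N ≠ 0) (hMN : M * N = N * M) :
    ∃ x y : F, M = x • (1 : Matrix (Fin 2) (Fin 2) F) + y • N := by
  rw [trace_fin_two] at hN
  have h1 : N 1 1 = -N 0 0 := by linear_combination hN
  have e00 := congrFun (congrFun hMN 0) 0
  have e01 := congrFun (congrFun hMN 0) 1
  have e10 := congrFun (congrFun hMN 1) 0
  simp only [mul_apply, Fin.sum_univ_two, h1] at e00 e01 e10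
  suffices ∃ y : F, M 0 1 = y * N 0 1 ∧ M 1 0 = y * N 1 0 ∧
      M 0 0 - M 1 1 = 2 * y * N 0 0 by
    obtain ⟨y, hy1, hy2, hy3⟩ := this
    refine ⟨M 0 0 - y * N 0 0, y, ?_⟩
    ext i j
    fin_cases i <;> fin_cases j <;> simp [h1]
    · exact hy1
    · exact hy2
    · linear_combination -hy3
  by_cases hb : N 0 1 = 0
  · by_cases hc : N 1 0 = 0
    · have ha : N 0 0 ≠ 0 := by
        intro ha
        apply hN0
        ext i j
        fin_cases i <;> fin_cases j <;> simp [ha, hb, hc, h1]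
      refine ⟨(M 0 0 - M 1 1) / (2 * N 0 0), ?_, ?_, ?_⟩
      · have : 2 * N 0 0 * M 0 1 = 0 := by rw [hb] at e01; linear_combination -e01
        simpa [hb, h2, ha] using this
      · have : 2 * N 0 0 * M 1 0 = 0 := by rw [hc] at e10; linear_combination e10
        simpa [hc, h2, ha] using this
      · field_simp
    · refine ⟨M 1 0 / N 1 0, ?_, ?_, ?_⟩
      · field_simp
        linear_combination e00
      · field_simp
      · field_simp
        linear_combination -e10
  · refine ⟨M 0 1 / N 0 1, ?_, ?_, ?_⟩
    · field_simp
    · field_simp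
      linear_combination -e00
    · field_simp
      linear_combination e01

/-- A nonzero traceless matrix has a cyclic vector, so up to a scalar it is determined up to
conjugacy by the square class of its discriminant. -/
lemma exists_conj_smul_of_trace_eq_zero (h2 : (2 : F) ≠ 0) {N : Matrix (Fin 2) (Fin 2) F}
    (hN : N.trace = 0) (hN0 : N ≠ 0) {c d : F} (hc : c ≠ 0) (hd : -N.det = d * c ^ 2) :
    ∃ P : Matrix (Fin 2) (Fin 2) F, P.det ≠ 0 ∧ N * P = c • (P * !![0, d; 1, 0]) := by
  rw [trace_fin_two] at hN
  have h1 : N 1 1 = -N 0 0 := by linear_combination hN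
  rw [det_fin_two, h1] at hd
  suffices ∃ u v : F, u * (N 1 0 * u + N 1 1 * v) - (N 0 0 * u + N 0 1 * v) * v ≠ 0 by
    obtain ⟨u, v, huv⟩ := this
    refine ⟨!![u, c⁻¹ * (N 0 0 * u + N 0 1 * v); v, c⁻¹ * (N 1 0 * u + N 1 1 * v)], ?_, ?_⟩
    · rw [det_fin_two_of]
      intro h
      apply huv
      field_simp at h
      linear_combination h
    · ext i j
      fin_cases i <;> fin_cases j <;> simp [mul_apply, h1] <;> field_simp
      · linear_combination u * hd
      · linear_combination v * hd
  by_cases hc' : N 1 0 = 0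
  · by_cases hb : N 0 1 = 0
    · refine ⟨1, 1, ?_⟩
      have ha : N 0 0 ≠ 0 := by
        intro ha
        apply hN0
        ext i j
        fin_cases i <;> fin_cases j <;> simp [ha, hb, hc', h1]
      rw [hb, hc', h1]
      have := mul_ne_zero h2 ha
      intro h
      apply this
      linear_combination -h
    · exact ⟨0, 1, by simpa using hb⟩
  · exact ⟨1, 0, by simpa using hc'⟩

lemma smul_one_add_smul_pow_card {p e : ℕ} [Fact p.Prime] [CharP F p] [Fintype F]
    (hF : Fintype.card F = p ^ e) (hodd : Odd (p ^ e)) {N : Matrix (Fin 2) (Fin 2) F} {D : F}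
    (hN : N * N = D • (1 : Matrix (Fin 2) (Fin 2) F)) (x y : F) :
    (x • (1 : Matrix (Fin 2) (Fin 2) F) + y • N) ^ p ^ e =
      x • (1 : Matrix (Fin 2) (Fin 2) F) + (y * D ^ (p ^ e / 2)) • N := by
  have hx (z : F) : z ^ p ^ e = z := hF ▸ FiniteField.pow_card z
  have hNq : N ^ p ^ e = D ^ (p ^ e / 2) • N := by
    obtain ⟨k, hk⟩ := hodd
    have : p ^ e / 2 = k := by omega
    rw [this, hk, pow_succ, pow_mul, sq, hN, smul_pow, one_pow, smul_mul_assoc, one_mul]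
  rw [add_pow_char_pow_of_commute p e ((Commute.one_left N).smul_left x |>.smul_right y),
    smul_pow, smul_pow, one_pow, hx, hx, hNq, smul_smul]

end MatrixTwo

section ProjectiveLinear

variable {F : Type*} [Field F]

lemma PGL2.mk_eq_one_iff_s7 (M : GL (Fin 2) F) :
    (QuotientGroup.mk M : PGL2 F) = 1 ↔
      ∃ c : F, (M : Matrix (Fin 2) (Fin 2) F) = c • (1 : Matrix (Fin 2) (Fin 2) F) := by
  rw [QuotientGroup.eq_one_iff, GeneralLinearGroup.mem_center_iff_val_mem_range_scalar]
  simp only [Set.mem_range, Matrix.smul_one_eq_diagonal, Matrix.scalar_apply, eq_comm]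

/-- The matrix `!![0, d; 1, 0]`, whose image in `PGL₂(F)` is an involution. -/
def antidiagGL (d : Fˣ) : GL (Fin 2) F :=
  GeneralLinearGroup.mkOfDetNeZero !![0, (d : F); 1, 0] (by simp)

lemma PGL2.mk_antidiagGL_ne_one (d : Fˣ) : (QuotientGroup.mk (antidiagGL d) : PGL2 F) ≠ 1 := by
  rw [Ne, PGL2.mk_eq_one_iff_s7]
  rintro ⟨c, hc⟩
  simpa [antidiagGL, GeneralLinearGroup.mkOfDetNeZero, GeneralLinearGroup.mk', unitOfDetInvertible]
    using congrFun (congrFun hc 1) 0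

lemma PGL2.exists_eq_conj_antidiagGL (h2 : (2 : F) ≠ 0) (N : GL (Fin 2) F)
    (hN : (N : Matrix (Fin 2) (Fin 2) F).trace = 0) (d : Fˣ) {c : F} (hc : c ≠ 0)
    (hd : -(N : Matrix (Fin 2) (Fin 2) F).det = d * c ^ 2) :
    ∃ g : PGL2 F, (QuotientGroup.mk (antidiagGL d) : PGL2 F) = g * QuotientGroup.mk N * g⁻¹ := by
  obtain ⟨P, hP, hNP⟩ := exists_conj_smul_of_trace_eq_zero h2 hN N.ne_zero hc hd
  let Q : GL (Fin 2) F := GeneralLinearGroup.mkOfDetNeZero P hP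
  refine ⟨(QuotientGroup.mk Q)⁻¹, ?_⟩
  have key : (QuotientGroup.mk (N * Q) : PGL2 F) = QuotientGroup.mk (Q * antidiagGL d) := by
    rw [eq_comm, QuotientGroup.eq, ← QuotientGroup.eq_one_iff, PGL2.mk_eq_one_iff_s7]
    refine ⟨c, ?_⟩
    have : ((N * Q : GL (Fin 2) F) : Matrix (Fin 2) (Fin 2) F) =
        c • ((Q * antidiagGL d : GL (Fin 2) F) : Matrix (Fin 2) (Fin 2) F) := hNP
    rw [Units.val_mul, this, mul_smul_comm, Units.inv_mul]
  rw [QuotientGroup.mk_mul, QuotientGroup.mk_mul] at key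
  rw [inv_inv, mul_assoc, key, inv_mul_cancel_left]

variable [Fintype F]

/-- An element of even order of `PGL₂(q)` lies in a split or in a non-split torus, and some
power of it is the involution of that torus. -/
lemma PGL2.orderOf_dvd_and_mem_conjPowers {p e : ℕ} [Fact p.Prime] [CharP F p]
    (hodd : Odd p) (hF : Fintype.card F = p ^ e) {ν : Fˣ} (hν : ¬IsSquare (ν : F))
    (g : PGL2 F) (hg : Even (orderOf g)) :
    (orderOf g ∣ p ^ e - 1 ∧ (QuotientGroup.mk (antidiagGL 1) : PGL2 F) ∈ conjPowers g) ∨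
    (orderOf g ∣ p ^ e + 1 ∧ (QuotientGroup.mk (antidiagGL ν) : PGL2 F) ∈ conjPowers g) := by
  have hchar : ringChar F ≠ 2 := by
    rw [ringChar.eq F p]
    rintro rfl
    exact absurd hodd (by decide)
  have h2 : (2 : F) ≠ 0 := Ring.two_ne_zero hchar
  obtain ⟨k, hk⟩ := hg
  have hpos := orderOf_pos g
  obtain ⟨M, rfl⟩ := QuotientGroup.mk_surjective g
  set N : GL (Fin 2) F := M ^ k with hNdef
  have hsq : (QuotientGroup.mk (N * N) : PGL2 F) = 1 := by
    rw [hNdef, ← pow_add, QuotientGroup.mk_pow, ← hk, pow_orderOf_eq_one]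
  have hne : (QuotientGroup.mk N : PGL2 F) ≠ 1 := by
    rw [hNdef, QuotientGroup.mk_pow]
    exact pow_ne_one_of_lt_orderOf (by omega) (by omega)
  rw [PGL2.mk_eq_one_iff_s7] at hsq
  rw [Ne, PGL2.mk_eq_one_iff_s7, not_exists] at hne
  obtain ⟨s, hs⟩ := hsq
  have htr := trace_eq_zero_of_mul_self hs hne
  have hNN := mul_self_eq_of_trace_eq_zero htr
  obtain ⟨x, y, hM⟩ := exists_eq_smul_one_add_smul_of_commute h2 htr N.ne_zero
    (congrArg Units.val (Commute.self_pow M k).eq)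
  have hpow := smul_one_add_smul_pow_card hF hodd.pow hNN x y
  rw [← hM] at hpow
  have hcard : Fintype.card F / 2 = p ^ e / 2 := by rw [hF]
  have hD : -(N : Matrix (Fin 2) (Fin 2) F).det ≠ 0 :=
    neg_ne_zero.mpr (GeneralLinearGroup.det N).ne_zero
  by_cases hsqD : IsSquare (-(N : Matrix (Fin 2) (Fin 2) F).det)
  · left
    rw [← hcard, (FiniteField.isSquare_iff hchar hD).mp hsqD, mul_one, ← hM] at hpow
    constructor
    · apply orderOf_dvd_of_pow_eq_one
      rw [← QuotientGroup.mk_pow]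
      have hpe : p ^ e = (p ^ e - 1) + 1 := by
        have := hodd.pow (n := e) |>.pos
        omega
      have : M ^ (p ^ e - 1) * M = 1 * M := by
        rw [← pow_succ, ← hpe, one_mul]
        exact Units.ext hpow
      rw [mul_right_cancel this, QuotientGroup.mk_one]
    · obtain ⟨c, hc⟩ := hsqD
      obtain ⟨h, hh⟩ := PGL2.exists_eq_conj_antidiagGL h2 N htr 1 (c := c)
        (by rintro rfl; simp [hc] at hD) (by rw [hc, Units.val_one]; ring)
      exact ⟨h, k, hh⟩
  · right
    have hDpow : (-(N : Matrix (Fin 2) (Fin 2) F).det) ^ (Fintype.card F / 2) = -1 :=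
      (FiniteField.pow_dichotomy hchar hD).resolve_left
        fun h ↦ hsqD ((FiniteField.isSquare_iff hchar hD).mpr h)
    have hνpow : (ν : F) ^ (Fintype.card F / 2) = -1 :=
      (FiniteField.pow_dichotomy hchar ν.ne_zero).resolve_left
        fun h ↦ hν ((FiniteField.isSquare_iff hchar ν.ne_zero).mpr h)
    constructor
    · apply orderOf_dvd_of_pow_eq_one
      rw [← QuotientGroup.mk_pow, PGL2.mk_eq_one_iff_s7]
      refine ⟨x ^ 2 - y ^ 2 * -(N : Matrix (Fin 2) (Fin 2) F).det, ?_⟩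
      rw [← hcard, hDpow] at hpow
      rw [Units.val_pow_eq_pow_val, pow_succ, hpow]
      rw [hM]
      simp only [mul_add, add_mul, smul_mul_assoc, mul_smul_comm, one_mul, mul_one, hNN,
        smul_smul, smul_add]
      module
    · have hquot : IsSquare (-(N : Matrix (Fin 2) (Fin 2) F).det / ν) := by
        rw [FiniteField.isSquare_iff hchar (div_ne_zero hD ν.ne_zero), div_pow, hDpow, hνpow]
        norm_num
      obtain ⟨c, hc⟩ := hquot
      rw [div_eq_iff ν.ne_zero] at hc
      obtain ⟨h, hh⟩ := PGL2.exists_eq_conj_antidiagGL h2 N htr ν (c := c)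
        (by rintro rfl; simp [hc] at hD) (by rw [hc]; ring)
      exact ⟨h, k, hh⟩

/-- Elements of odd order of `PGL₂(F)` have square determinant, so two of them never generate. -/
lemma PGL2.even_orderOf_of_closure_eq_top {a b : PGL2 F} {ν : Fˣ} (hν : ¬IsSquare (ν : F))
    (hchar : ringChar F ≠ 2) (hab : Subgroup.closure ({a, b} : Set (PGL2 F)) = ⊤) :
    Even (orderOf a) ∨ Even (orderOf b) := by
  let n := Fintype.card F / 2
  have hn : n + n + 1 = Fintype.card F := by
    have := FiniteField.odd_card_of_char_ne_two hchar
    omega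
  let φ : GL (Fin 2) F →* Fˣ := (powMonoidHom n).comp GeneralLinearGroup.det
  have hφ (M : GL (Fin 2) F) : φ M = GeneralLinearGroup.det M ^ n := rfl
  have hunit (u : Fˣ) : u ^ (n + n) = 1 := by
    have := FiniteField.pow_card_sub_one_eq_one (u : F) u.ne_zero
    rw [← hn, Nat.add_sub_cancel] at this
    exact Units.ext (by simpa using this)
  have hker : Subgroup.center (GL (Fin 2) F) ≤ φ.ker := by
    intro M hM
    obtain ⟨c, hc⟩ := GeneralLinearGroup.mem_center_iff_val_mem_range_scalar.mp hM
    have hdet : (M : Matrix (Fin 2) (Fin 2) F).det = c * c := by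
      rw [← hc, ← sq]; simp
    have hc0 : c ≠ 0 := by
      rintro rfl
      exact (GeneralLinearGroup.det M).ne_zero (by simpa using hdet)
    rw [MonoidHom.mem_ker, hφ]
    have : GeneralLinearGroup.det M = Units.mk0 c hc0 * Units.mk0 c hc0 := Units.ext hdet
    rw [this, mul_pow, ← pow_add, hunit]
  let ψ : PGL2 F →* Fˣ := QuotientGroup.lift _ φ hker
  have hψ (g : PGL2 F) (hg : ¬Even (orderOf g)) : ψ g = 1 := by
    obtain ⟨m, hm⟩ := Nat.not_even_iff_odd.mp hg
    have hsq : ψ g ^ 2 = 1 := by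
      obtain ⟨M, rfl⟩ := QuotientGroup.mk_surjective g
      change φ M ^ 2 = 1
      rw [hφ, ← pow_mul, mul_two, hunit]
    have := congrArg ψ (pow_orderOf_eq_one g)
    rwa [hm, map_pow, pow_succ, pow_mul, hsq, one_pow, one_mul, map_one] at this
  by_contra! h
  have hone : ψ = 1 := by
    refine MonoidHom.eq_of_eqOn_dense hab ?_
    rintro g (rfl | rfl)
    · exact hψ g h.1
    · exact hψ g h.2
  apply hν
  have hdet : GeneralLinearGroup.det (antidiagGL (-ν)) = ν :=
    Units.ext (show (!![0, ((-ν : Fˣ) : F); 1, 0]).det = ν by simp)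
  have hφν : φ (antidiagGL (-ν)) = 1 := DFunLike.congr_fun hone (QuotientGroup.mk (antidiagGL (-ν)))
  rw [hφ, hdet] at hφν
  exact (FiniteField.unit_isSquare_iff hchar ν).mpr hφν |>.map (Units.coeHom F)

end ProjectiveLinear

/-- Let `G₁ = PGL₂(q)` with `3 < q = p ^ e`, `p` an odd prime.  If `G₁`
admits an unmixed Beauville structure of type `((r₁,s₁,t₁),(r₂,s₂,t₂))`, then either all
even entries of the first triple divide `q - 1` and all even entries of the second triple
divide `q + 1`, or vice versa. -/
theorem even_entries_divide_of_beauville_type_PGL2 (p e : ℕ) (hp : p.Prime) (hodd : Odd p)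
    (he : 0 < e) (hq : 3 < p ^ e)
    (F : Type*) [Field F] [Fintype F] (hF : Fintype.card F = p ^ e)
    (r₁ s₁ t₁ r₂ s₂ t₂ : ℕ)
    (h : HasBeauvilleOfType (PGL2 F) r₁ s₁ t₁ r₂ s₂ t₂) :
    ((∀ m ∈ [r₁, s₁, t₁], Even m → m ∣ p ^ e - 1) ∧
      (∀ m ∈ [r₂, s₂, t₂], Even m → m ∣ p ^ e + 1)) ∨
    ((∀ m ∈ [r₁, s₁, t₁], Even m → m ∣ p ^ e + 1) ∧
      (∀ m ∈ [r₂, s₂, t₂], Even m → m ∣ p ^ e - 1)) := by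
  obtain ⟨a₁, b₁, c₁, a₂, b₂, c₂, ⟨-, -, hgen₁, hgen₂, hint⟩, rfl, rfl, rfl, rfl, rfl, rfl⟩ := h
  have : Fact p.Prime := ⟨hp⟩
  have : CharP F p := charP_of_card_eq_prime_pow hF
  have hchar : ringChar F ≠ 2 := by
    rw [ringChar.eq F p]
    rintro rfl
    exact absurd hodd (by decide)
  obtain ⟨n, hn⟩ := FiniteField.exists_nonsquare hchar
  have hn0 : n ≠ 0 := by
    rintro rfl
    exact hn (IsSquare.zero)
  let ν : Fˣ := Units.mk0 n hn0
  have hν : ¬IsSquare (ν : F) := hn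
  have key (g : PGL2 F) := PGL2.orderOf_dvd_and_mem_conjPowers hodd hF hν g
  have mem_sigma {a b c g x : PGL2 F} (hg : g ∈ [a, b, c]) (hx : x ∈ conjPowers g) :
      x ∈ sigma3 a b c := by
    simp only [List.mem_cons, List.not_mem_nil, or_false] at hg
    rcases hg with rfl | rfl | rfl
    · exact Or.inl (Or.inl hx)
    · exact Or.inl (Or.inr hx)
    · exact Or.inr hx
  have disj {d : Fˣ} (h₁ : (QuotientGroup.mk (antidiagGL d) : PGL2 F) ∈ sigma3 a₁ b₁ c₁)
      (h₂ : (QuotientGroup.mk (antidiagGL d) : PGL2 F) ∈ sigma3 a₂ b₂ c₂) : False :=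
    PGL2.mk_antidiagGL_ne_one d (hint.subset ⟨h₁, h₂⟩)
  have exists_even {a b : PGL2 F} (c : PGL2 F)
      (hab : Subgroup.closure ({a, b} : Set (PGL2 F)) = ⊤) :
      ∃ g ∈ [a, b, c], Even (orderOf g) := by
    rcases PGL2.even_orderOf_of_closure_eq_top hν hchar hab with h | h
    · exact ⟨a, by simp, h⟩
    · exact ⟨b, by simp, h⟩
  obtain ⟨g₁, hg₁, hev₁⟩ := exists_even c₁ hgen₁
  obtain ⟨g₂, hg₂, hev₂⟩ := exists_even c₂ hgen₂
  have of_forall {a b c : PGL2 F} {k : ℕ}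
      (H : ∀ g ∈ [a, b, c], Even (orderOf g) → orderOf g ∣ k) :
      ∀ m ∈ [orderOf a, orderOf b, orderOf c], Even m → m ∣ k := by
    simpa using H
  rcases key g₁ hev₁ with ⟨-, h₁⟩ | ⟨-, h₁⟩
  · have H₂ (g : PGL2 F) (hg : g ∈ [a₂, b₂, c₂]) (hev : Even (orderOf g)) :=
      (key g hev).resolve_left fun h ↦ disj (mem_sigma hg₁ h₁) (mem_sigma hg h.2)
    have H₁ (g : PGL2 F) (hg : g ∈ [a₁, b₁, c₁]) (hev : Even (orderOf g)) :=
      (key g hev).resolve_right fun h ↦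
        disj (mem_sigma hg h.2) (mem_sigma hg₂ (H₂ g₂ hg₂ hev₂).2)
    exact Or.inl ⟨of_forall fun g hg hev ↦ (H₁ g hg hev).1,
      of_forall fun g hg hev ↦ (H₂ g hg hev).1⟩
  · have H₂ (g : PGL2 F) (hg : g ∈ [a₂, b₂, c₂]) (hev : Even (orderOf g)) :=
      (key g hev).resolve_right fun h ↦ disj (mem_sigma hg₁ h₁) (mem_sigma hg h.2)
    have H₁ (g : PGL2 F) (hg : g ∈ [a₁, b₁, c₁]) (hev : Even (orderOf g)) :=
      (key g hev).resolve_left fun h ↦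
        disj (mem_sigma hg h.2) (mem_sigma hg₂ (H₂ g₂ hg₂ hev₂).2)
    exact Or.inr ⟨of_forall fun g hg hev ↦ (H₁ g hg hev).1,
      of_forall fun g hg hev ↦ (H₂ g hg hev).1⟩
end

section
/- Let 3 < q = p^e for an odd prime p and a positive integer e. Then PSL₂(q²) admits an unmixed Beauville structure of type ((p,p,t₁),(p,p,t₂)) for some integers t₁ and t₂ with t₁ dividing (q²−1)/2 and t₂ dividing (q²+1)/2. -/
open Matrix

/-- The projective special linear group `PSL₂(F) = SL(2, F) / Z(SL(2, F))`. -/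
abbrev PSL2 (F : Type*) [Field F] :=
  Matrix.SpecialLinearGroup (Fin 2) F ⧸ Subgroup.center (Matrix.SpecialLinearGroup (Fin 2) F)

open Finset in
/-- A double count of the conjugates of `D` and `C` that lie in `B`: if elements outside `Z` have at
most two conjugates in `B` up to `B`, elements of `D` only one, and those of `C` none, then `B` and
`D` bound the order of `C`. -/
lemma card_mul_card_sub_two_lt {G : Type*} [Group G] [Fintype G] [DecidableEq G]
    (B C : Subgroup G) (D Z : Finset G) (hZ : #Z = 2)
    (hZcomm : ∀ z ∈ Z, ∀ g : G, g⁻¹ * z * g = z)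
    (hZB : ∀ z ∈ Z, z ∈ B) (hZC : ∀ z ∈ Z, z ∈ C) (hZD : Disjoint Z D)
    (hDB : ∀ d ∈ D, d ∈ B)
    (hB : ∀ h ∉ Z, ∀ g₀ g₁ g₂ : G, g₀⁻¹ * h * g₀ ∈ B → g₁⁻¹ * h * g₁ ∈ B → g₂⁻¹ * h * g₂ ∈ B →
      g₀⁻¹ * g₁ ∈ B ∨ g₀⁻¹ * g₂ ∈ B ∨ g₁⁻¹ * g₂ ∈ B)
    (hD : ∀ h g₀ g₁ : G, g₀⁻¹ * h * g₀ ∈ D → g₁⁻¹ * h * g₁ ∈ B → g₀⁻¹ * g₁ ∈ B)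
    (hCB : ∀ k ∈ C, k ∉ Z → ∀ g : G, g⁻¹ * k * g ∉ B)
    (hCC : ∀ k ∈ C, k ∉ Z → ∀ g : G, g⁻¹ * k * g = k → g ∈ C)
    (hCinv : ∀ k ∈ C, k ∉ Z → ∀ l ∈ C, l ∉ Z → ∀ g : G, g⁻¹ * k * g = l → l = k ∨ l = k⁻¹) :
    (Nat.card C : ℤ) * (#D - 2) < 2 * Nat.card B := by
  classical
  set b := (Nat.card B : ℤ) with hb
  set c := (Nat.card C : ℤ) with hc
  set n := (Fintype.card G : ℤ) with hn
  have hbpos : 0 < b := by rw [hb]; exact_mod_cast Nat.card_pos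
  have hcpos : 0 < c := by rw [hc]; exact_mod_cast Nat.card_pos
  have hnpos : 0 < n := by simp [hn, Fintype.card_pos]
  have coset : ∀ (S : Subgroup G) (g : G), (#{x | g⁻¹ * x ∈ S} : ℤ) = Nat.card S := by
    intro S g
    rw [Nat.card_eq_fintype_card, Fintype.card_subtype]
    norm_cast
    refine card_bij' (fun x _ => g⁻¹ * x) (fun x _ => g * x) ?_ ?_ ?_ ?_ <;> simp
  have swap : ∀ (P : G → Prop) [DecidablePred P],
      (∑ h : G, (#{g | P (g⁻¹ * h * g)} : ℤ)) = n * #{h | P h} := by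
    intro P _
    have h1 := sum_card_bipartiteAbove_eq_sum_card_bipartiteBelow (s := (univ : Finset G))
      (t := (univ : Finset G)) (fun h g => P (g⁻¹ * h * g))
    have h2 : ∀ g : G, #{h | P (g⁻¹ * h * g)} = #{h | P h} := by
      intro g
      refine card_bij' (fun h _ => g⁻¹ * h * g) (fun h _ => g * h * g⁻¹) ?_ ?_ ?_ ?_ <;>
        simp [mul_assoc]
    simp only [bipartiteAbove, bipartiteBelow, h2, sum_const, card_univ, smul_eq_mul] at h1
    rw [hn]
    exact_mod_cast h1
  set F : Finset G := {h | ∃ g : G, g⁻¹ * h * g ∈ B} with hF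
  -- elements of the conjugates of `B`
  have main1 : n * (b + #D) ≤ 2 * b * #F + 2 * (n - 2 * b) := by
    have hbB : (#{h | h ∈ B} : ℤ) = b := by simpa only [inv_one, one_mul] using coset B 1
    have hDD : #{h | h ∈ D} = #D := by simp
    have e : n * (b + #D) = ∑ h : G, ((#{g | g⁻¹ * h * g ∈ B} : ℤ) + #{g | g⁻¹ * h * g ∈ D}) := by
      rw [sum_add_distrib, swap (· ∈ B), swap (· ∈ D), hbB, hDD, mul_add]
    have e2 : 2 * b * #F + 2 * (n - 2 * b)
        = ∑ h : G, ((if h ∈ F then 2 * b else 0) + (if h ∈ Z then n - 2 * b else 0)) := by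
      rw [sum_add_distrib, ← sum_filter, ← sum_filter]
      simp only [filter_univ_mem, sum_const, nsmul_eq_mul, hZ]
      push_cast
      ring
    rw [e, e2]
    refine sum_le_sum fun h _ => ?_
    by_cases hz : h ∈ Z
    · have h1 : #{g | g⁻¹ * h * g ∈ D} = 0 := by
        simp [hZcomm h hz, Finset.disjoint_left.1 hZD hz]
      have h2 : (#{g | g⁻¹ * h * g ∈ B} : ℤ) = n := by
        simp [hZcomm h hz, hZB h hz, hn]
      have h3 : h ∈ F := by simpa [hF] using ⟨1, by simpa using hZB h hz⟩
      simp [h1, h2, h3, hz]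
    · simp only [hz, if_false, add_zero]
      split_ifs with hf
      · have bound : ∀ g₀ : G, (∀ g, g⁻¹ * h * g ∈ B → g₀⁻¹ * g ∈ B) →
            (#{g | g⁻¹ * h * g ∈ B} : ℤ) ≤ b := by
          intro g₀ h0
          rw [hb, ← coset B g₀]
          exact_mod_cast card_le_card (monotone_filter_right _ fun g _ hg => h0 g hg)
        have le : (#{g | g⁻¹ * h * g ∈ D} : ℤ) ≤ #{g | g⁻¹ * h * g ∈ B} := by
          exact_mod_cast card_le_card (monotone_filter_right _ fun g _ hg => hDB _ hg)
        by_cases hd : ∃ g₀, g₀⁻¹ * h * g₀ ∈ D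
        · obtain ⟨g₀, hg₀⟩ := hd
          have := bound g₀ fun g hg => hD h g₀ g hg₀ hg
          linarith
        · have h1 : #{g | g⁻¹ * h * g ∈ D} = 0 := by
            push Not at hd
            simp [hd]
          rw [h1]
          obtain ⟨g₀, hg₀⟩ : ∃ g : G, g⁻¹ * h * g ∈ B := by simpa [hF] using hf
          by_cases hg : ∀ g, g⁻¹ * h * g ∈ B → g₀⁻¹ * g ∈ B
          · have := bound g₀ hg
            simp only [Nat.cast_zero]
            linarith
          · push Not at hg
            obtain ⟨g₁, hg₁, hg₀₁⟩ := hg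
            have : #{g | g⁻¹ * h * g ∈ B} ≤ #{x | g₀⁻¹ * x ∈ B} + #{x | g₁⁻¹ * x ∈ B} := by
              refine (card_le_card ?_).trans (card_union_le _ _)
              intro g hg
              have := hB h hz g₀ g₁ g hg₀ hg₁ (by simpa using hg)
              simp only [mem_union, mem_filter, mem_univ, true_and]
              tauto
            have := (Nat.cast_le (α := ℤ)).2 this
            push_cast at this
            rw [coset, coset] at this
            simp only [Nat.cast_zero]
            linarith
      · have h2 : ∀ g, g⁻¹ * h * g ∉ B := by simpa [hF] using hf
        have h3 : ∀ g, g⁻¹ * h * g ∉ D := fun g hg => h2 g (hDB _ hg)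
        simp [h2, h3]
  -- elements conjugate into `C`
  have main2 : n * (c - 2) ≤ 2 * c * (n - #F) := by
    set T : Finset G := {k | k ∈ C ∧ k ∉ Z} with hT
    have hTcard : (#T : ℤ) = c - 2 := by
      have h1 : T = ({k | k ∈ C} : Finset G) \ Z := by ext; simp [hT]
      have h2 : (#{k | k ∈ C} : ℤ) = c := by simpa only [inv_one, one_mul] using coset C 1
      rw [h1, card_sdiff_of_subset (fun z hz => by simpa using hZC z hz), Nat.cast_sub
        (card_le_card (fun z hz => by simpa using hZC z hz)), h2, hZ]
      simp
    have hN : (#(Fᶜ) : ℤ) = n - #F := by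
      rw [card_compl, Nat.cast_sub (card_le_univ _)]
    have e1 : ∀ k ∈ T, (∑ x ∈ Fᶜ, (#{g | g⁻¹ * x * g = k} : ℤ)) = n := by
      intro k hk
      have hk' : k ∈ C ∧ k ∉ Z := by simpa [hT] using hk
      have h1 := swap (· = k)
      simp only [filter_eq', mem_univ, if_true, card_singleton, Nat.cast_one, mul_one] at h1
      rw [← h1]
      refine sum_subset (subset_univ _) fun x _ hx => ?_
      have : ∃ g : G, g⁻¹ * x * g ∈ B := by simpa [hF] using hx
      obtain ⟨g, hg⟩ := this
      simp only [Nat.cast_eq_zero, card_eq_zero, filter_eq_empty_iff, mem_univ, true_imp_iff]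
      intro g' h'
      refine hCB k hk'.1 hk'.2 (g'⁻¹ * g) ?_
      rw [← h']
      simpa [mul_assoc] using hg
    have e2 : ∀ x : G, (∑ k ∈ T, (#{g | g⁻¹ * x * g = k} : ℤ)) ≤ 2 * c := by
      intro x
      have one : ∀ k ∈ T, (#{g | g⁻¹ * x * g = k} : ℤ) ≤ c := by
        intro k hk
        have hk' : k ∈ C ∧ k ∉ Z := by simpa [hT] using hk
        by_cases he : ∃ g₀, g₀⁻¹ * x * g₀ = k
        · obtain ⟨g₀, hg₀⟩ := he
          rw [hc, ← coset C g₀]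
          norm_cast
          refine card_le_card (monotone_filter_right _ fun g _ hg => ?_)
          refine hCC k hk'.1 hk'.2 _ ?_
          calc (g₀⁻¹ * g)⁻¹ * k * (g₀⁻¹ * g) = (g₀⁻¹ * g)⁻¹ * (g₀⁻¹ * x * g₀) * (g₀⁻¹ * g) := by
                rw [hg₀]
            _ = g⁻¹ * x * g := by group
            _ = k := hg
        · push Not at he
          simp [he, hcpos.le]
      by_cases he : ∃ k₀ ∈ T, ∃ g₀, g₀⁻¹ * x * g₀ = k₀
      · obtain ⟨k₀, hk₀, g₀, hg₀⟩ := he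
        have hk₀' : k₀ ∈ C ∧ k₀ ∉ Z := by simpa [hT] using hk₀
        have sub : ∀ k ∈ T, k ∉ T ∩ {k₀, k₀⁻¹} → (#{g | g⁻¹ * x * g = k} : ℤ) = 0 := by
          intro k hk hne
          have hk' : k ∈ C ∧ k ∉ Z := by simpa [hT] using hk
          simp only [Nat.cast_eq_zero, card_eq_zero, filter_eq_empty_iff, mem_univ, true_imp_iff]
          intro g hg
          have := hCinv k₀ hk₀'.1 hk₀'.2 k hk'.1 hk'.2 (g₀⁻¹ * g) (by
            rw [← hg₀, ← hg]; group)
          simp only [mem_inter, mem_insert, mem_singleton] at hne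
          tauto
        rw [← sum_subset inter_subset_left sub]
        calc _ ≤ ∑ k ∈ T ∩ {k₀, k₀⁻¹}, c := sum_le_sum fun k hk => one k (mem_inter.1 hk).1
          _ = #(T ∩ {k₀, k₀⁻¹}) * c := by simp
          _ ≤ 2 * c := by
            have : #(T ∩ {k₀, k₀⁻¹}) ≤ 2 := (card_le_card inter_subset_right).trans card_le_two
            gcongr
            exact_mod_cast this
      · push Not at he
        rw [sum_eq_zero]
        · positivity
        · intro k hk
          simp [he k hk]
    calc n * (c - 2) = ∑ k ∈ T, ∑ x ∈ Fᶜ, (#{g | g⁻¹ * x * g = k} : ℤ) := by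
          rw [sum_congr rfl e1, sum_const, nsmul_eq_mul, hTcard, mul_comm]
      _ = ∑ x ∈ Fᶜ, ∑ k ∈ T, (#{g | g⁻¹ * x * g = k} : ℤ) := sum_comm
      _ ≤ ∑ x ∈ Fᶜ, 2 * c := sum_le_sum fun x _ => e2 x
      _ = 2 * c * (n - #F) := by rw [sum_const, nsmul_eq_mul, hN, mul_comm]
  nlinarith [mul_pos hbpos hcpos, mul_le_mul_of_nonneg_left main1 hcpos.le,
    mul_le_mul_of_nonneg_left main2 hbpos.le]

namespace SL2

variable {K : Type*} [Field K]

local notation "SL₂" => Matrix.SpecialLinearGroup (Fin 2)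

/-- The upper unitriangular matrix with entry `x`. -/
def upper (x : K) : SL₂ K := ⟨!![1, x; 0, 1], by simp⟩

/-- The lower unitriangular matrix with entry `x`. -/
def lower (x : K) : SL₂ K := ⟨!![1, 0; x, 1], by simp⟩

/-- The entries of a matrix in `SL₂`. -/
def entry (A : SL₂ K) (i j : Fin 2) : K := A.1 i j

/-- The trace of a matrix in `SL₂`. -/
def tr (A : SL₂ K) : K := entry A 0 0 + entry A 1 1

@[simp] lemma entry_mk (M : Matrix (Fin 2) (Fin 2) K) (h : M.det = 1) (i j : Fin 2) :
    entry ⟨M, h⟩ i j = M i j := rfl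

@[simp] lemma entry_mul (A B : SL₂ K) (i j : Fin 2) :
    entry (A * B) i j = entry A i 0 * entry B 0 j + entry A i 1 * entry B 1 j :=
  (Matrix.mul_apply (M := A.1) (N := B.1)).trans (Fin.sum_univ_two _)

@[simp] lemma entry_inv_zero_zero (A : SL₂ K) : entry A⁻¹ 0 0 = entry A 1 1 :=
  congrFun₂ (Matrix.adjugate_fin_two A.1) 0 0

@[simp] lemma entry_inv_zero_one (A : SL₂ K) : entry A⁻¹ 0 1 = -entry A 0 1 :=
  congrFun₂ (Matrix.adjugate_fin_two A.1) 0 1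

@[simp] lemma entry_inv_one_zero (A : SL₂ K) : entry A⁻¹ 1 0 = -entry A 1 0 :=
  congrFun₂ (Matrix.adjugate_fin_two A.1) 1 0

@[simp] lemma entry_inv_one_one (A : SL₂ K) : entry A⁻¹ 1 1 = entry A 0 0 :=
  congrFun₂ (Matrix.adjugate_fin_two A.1) 1 1

@[simp] lemma entry_one (i j : Fin 2) : entry (1 : SL₂ K) i j = if i = j then 1 else 0 :=
  Matrix.one_apply

@[simp] lemma entry_neg (A : SL₂ K) (i j : Fin 2) : entry (-A) i j = -entry A i j := rfl

@[simp] lemma entry_upper (x : K) (i j : Fin 2) :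
    entry (upper x) i j = (!![1, x; 0, 1] : Matrix (Fin 2) (Fin 2) K) i j := rfl

@[simp] lemma entry_lower (x : K) (i j : Fin 2) :
    entry (lower x) i j = (!![1, 0; x, 1] : Matrix (Fin 2) (Fin 2) K) i j := rfl

lemma det_eq (A : SL₂ K) :
    entry A 0 0 * entry A 1 1 - entry A 0 1 * entry A 1 0 = 1 :=
  (Matrix.det_fin_two A.1).symm.trans A.2

lemma eq_iff {A B : SL₂ K} : A = B ↔ entry A 0 0 = entry B 0 0 ∧ entry A 0 1 = entry B 0 1 ∧
    entry A 1 0 = entry B 1 0 ∧ entry A 1 1 = entry B 1 1 := by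
  refine ⟨by rintro rfl; simp, fun ⟨h1, h2, h3, h4⟩ => ?_⟩
  ext i j
  fin_cases i <;> fin_cases j <;> assumption

lemma upper_add (x y : K) : upper (x + y) = upper x * upper y := by
  simp [eq_iff, add_comm]

lemma upper_neg (x : K) : upper (-x) = (upper x)⁻¹ := by simp [eq_iff]

lemma upper_zero : upper (0 : K) = 1 := by simp [eq_iff]

lemma upper_pow (x : K) (n : ℕ) : upper x ^ n = upper (n * x) := by
  induction n with
  | zero => simp [upper_zero]
  | succ n ih => rw [pow_succ, ih, ← upper_add]; congr 1; push_cast; ring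

lemma lower_pow (x : K) (n : ℕ) : lower x ^ n = lower (n * x) := by
  induction n with
  | zero => simp [eq_iff]
  | succ n ih =>
    rw [pow_succ, ih]
    simp [eq_iff]
    ring

lemma upper_injective : Function.Injective (upper : K → SL₂ K) := fun x y h => by
  simpa using (eq_iff.1 h).2.1

/-- The Weyl element, which swaps upper and lower unitriangular matrices. -/
def weyl : SL₂ K := ⟨!![0, 1; -1, 0], by simp⟩

@[simp] lemma entry_weyl (i j : Fin 2) :
    entry (weyl : SL₂ K) i j = (!![0, 1; -1, 0] : Matrix (Fin 2) (Fin 2) K) i j := rfl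

lemma lower_eq_conj (x : K) : lower x = weyl * upper (-x) * weyl⁻¹ := by
  simp [eq_iff]

/-- Lower left entry of a conjugate. -/
lemma conj_apply_one_zero (g h : SL₂ K) : entry (g⁻¹ * h * g) 1 0 =
    entry h 1 0 * entry g 0 0 ^ 2 + (entry h 1 1 - entry h 0 0) * (entry g 0 0 * entry g 1 0)
      - entry h 0 1 * entry g 1 0 ^ 2 := by
  simp
  ring

lemma inv_mul_apply_one_zero (g h : SL₂ K) :
    entry (g⁻¹ * h) 1 0 = entry g 0 0 * entry h 1 0 - entry g 1 0 * entry h 0 0 := by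
  simp
  ring

lemma trace_conj (g h : SL₂ K) : tr (g⁻¹ * h * g) = tr h := by
  have hg := det_eq g
  simp [tr]
  linear_combination (entry h 0 0 + entry h 1 1) * hg

lemma eq_one_or_neg_one {h : SL₂ K} (h1 : entry h 0 1 = 0) (h2 : entry h 1 0 = 0)
    (h3 : entry h 0 0 = entry h 1 1) : h = 1 ∨ h = -1 := by
  have := det_eq h
  rw [h1, ← h3, zero_mul, sub_zero, mul_self_eq_one_iff] at this
  refine this.imp (fun ha => ?_) fun ha => ?_
  · simp [eq_iff, h1, h2, ← h3, ha]
  · simp [eq_iff, h1, h2, ← h3, ha]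

/-- A matrix of `SL₂` other than `±1` has at most two eigenlines. -/
lemma eigenline_le_two {h : SL₂ K} (h1 : h ≠ 1) (h2 : h ≠ -1) {g₀ g₁ g₂ : SL₂ K}
    (e₀ : entry (g₀⁻¹ * h * g₀) 1 0 = 0) (e₁ : entry (g₁⁻¹ * h * g₁) 1 0 = 0)
    (e₂ : entry (g₂⁻¹ * h * g₂) 1 0 = 0) :
    entry (g₀⁻¹ * g₁) 1 0 = 0 ∨ entry (g₀⁻¹ * g₂) 1 0 = 0 ∨ entry (g₁⁻¹ * g₂) 1 0 = 0 := by
  by_contra! hne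
  obtain ⟨n1, n2, n3⟩ := hne
  rw [conj_apply_one_zero] at e₀ e₁ e₂
  rw [inv_mul_apply_one_zero] at n1 n2 n3
  set p₀ := entry g₀ 0 0
  set r₀ := entry g₀ 1 0
  set p₁ := entry g₁ 0 0
  set r₁ := entry g₁ 1 0
  set p₂ := entry g₂ 0 0
  set r₂ := entry g₂ 1 0
  have hn := mul_ne_zero (mul_ne_zero n1 n2) n3
  have hc : entry h 1 0 = 0 := by
    refine (mul_eq_zero.1 ?_).resolve_right hn
    linear_combination e₀ * (r₁ * r₂ * (p₁ * r₂ - r₁ * p₂)) - e₁ * (r₀ * r₂ * (p₀ * r₂ - r₀ * p₂))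
      + e₂ * (r₀ * r₁ * (p₀ * r₁ - r₀ * p₁))
  have hb : entry h 0 1 = 0 := by
    refine (mul_eq_zero.1 ?_).resolve_right hn
    linear_combination - e₀ * (p₁ * p₂ * (p₁ * r₂ - r₁ * p₂))
      + e₁ * (p₀ * p₂ * (p₀ * r₂ - r₀ * p₂)) - e₂ * (p₀ * p₁ * (p₀ * r₁ - r₀ * p₁))
  have he : entry h 1 1 - entry h 0 0 = 0 := by
    refine (mul_eq_zero.1 ?_).resolve_right hn
    linear_combination -e₀ * ((p₁ * r₂) ^ 2 - (r₁ * p₂) ^ 2) + e₁ * ((p₀ * r₂) ^ 2 - (r₀ * p₂) ^ 2)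
      - e₂ * ((p₀ * r₁) ^ 2 - (r₀ * p₁) ^ 2)
  rcases eq_one_or_neg_one hb hc (by linear_combination -he) with h | h
  exacts [h1 h, h2 h]

/-- A transvection, up to sign, has only one eigenline. -/
lemma eigenline_le_one {h g₀ g₁ : SL₂ K} (e₀ : entry (g₀⁻¹ * h * g₀) 1 0 = 0)
    (ed : entry (g₀⁻¹ * h * g₀) 0 0 = entry (g₀⁻¹ * h * g₀) 1 1)
    (eb : entry (g₀⁻¹ * h * g₀) 0 1 ≠ 0)
    (e₁ : entry (g₁⁻¹ * h * g₁) 1 0 = 0) : entry (g₀⁻¹ * g₁) 1 0 = 0 := by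
  have : g₁⁻¹ * h * g₁ = (g₀⁻¹ * g₁)⁻¹ * (g₀⁻¹ * h * g₀) * (g₀⁻¹ * g₁) := by group
  rw [this] at e₁
  generalize g₀⁻¹ * g₁ = x at e₁ ⊢
  generalize g₀⁻¹ * h * g₀ = k at *
  rw [conj_apply_one_zero, e₀, ed] at e₁
  simpa [eb] using e₁

lemma commute_iff {A B : SL₂ K} : A * B = B * A ↔
    entry A 0 1 * entry B 1 0 = entry B 0 1 * entry A 1 0 ∧
    (entry A 0 0 - entry A 1 1) * entry B 0 1 = (entry B 0 0 - entry B 1 1) * entry A 0 1 ∧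
    (entry A 0 0 - entry A 1 1) * entry B 1 0 = (entry B 0 0 - entry B 1 1) * entry A 1 0 := by
  simp only [eq_iff, entry_mul]
  constructor
  · rintro ⟨h1, h2, h3, h4⟩
    refine ⟨by linear_combination h1, by linear_combination h2, by linear_combination -h3⟩
  · rintro ⟨h1, h2, h3⟩
    refine ⟨by linear_combination h1, by linear_combination h2, by linear_combination -h3,
      by linear_combination -h1⟩

/-- A matrix commuting with `M ≠ ±1` is a combination of `M` and a scalar. -/
lemma exists_smul_of_commute {M A : SL₂ K} (h1 : M ≠ 1) (h2 : M ≠ -1) (h : A * M = M * A) :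
    ∃ y : K, entry A 0 1 = y * entry M 0 1 ∧ entry A 1 0 = y * entry M 1 0 ∧
      entry A 0 0 - entry A 1 1 = y * (entry M 0 0 - entry M 1 1) := by
  obtain ⟨e1, e2, e3⟩ := commute_iff.1 h
  by_cases hb : entry M 0 1 = 0
  · by_cases hc : entry M 1 0 = 0
    · have hd : entry M 0 0 - entry M 1 1 ≠ 0 := fun hd => by
        rcases eq_one_or_neg_one hb hc (by linear_combination hd) with h | h
        exacts [h1 h, h2 h]
      refine ⟨(entry A 0 0 - entry A 1 1) / (entry M 0 0 - entry M 1 1), ?_, ?_, ?_⟩ <;>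
        field_simp <;>
        first | linear_combination e1 | linear_combination -e2 | linear_combination -e3
    · refine ⟨entry A 1 0 / entry M 1 0, ?_, ?_, ?_⟩ <;> field_simp <;>
        first | linear_combination e1 | linear_combination e3
  · refine ⟨entry A 0 1 / entry M 0 1, ?_, ?_, ?_⟩ <;> field_simp <;>
      first | linear_combination -e1 | linear_combination e2

lemma commute_trans {M A B : SL₂ K} (h1 : M ≠ 1) (h2 : M ≠ -1) (hA : A * M = M * A)
    (hB : B * M = M * B) : A * B = B * A := by
  obtain ⟨y, a1, a2, a3⟩ := exists_smul_of_commute h1 h2 hA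
  obtain ⟨z, b1, b2, b3⟩ := exists_smul_of_commute h1 h2 hB
  rw [commute_iff, a1, a2, a3, b1, b2, b3]
  refine ⟨?_, ?_, ?_⟩ <;> ring

/-- Commuting matrices share the eigenlines of the nonscalar one. -/
lemma eigenline_of_commute {k M g : SL₂ K} (h1 : k ≠ 1) (h2 : k ≠ -1) (hM : M * k = k * M)
    (hk : entry (g⁻¹ * k * g) 1 0 = 0) : entry (g⁻¹ * M * g) 1 0 = 0 := by
  obtain ⟨y, a1, a2, a3⟩ := exists_smul_of_commute h1 h2 hM
  rw [conj_apply_one_zero] at hk ⊢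
  rw [a1, a2]
  linear_combination y * hk - (entry g 0 0 * entry g 1 0) * a3

lemma discr_eq (A : SL₂ K) :
    (entry A 0 0 - entry A 1 1) ^ 2 + 4 * (entry A 0 1 * entry A 1 0) = tr A ^ 2 - 4 := by
  rw [tr]
  linear_combination -4 * det_eq A

lemma ne_one_of_trace {M : SL₂ K} (hM : tr M ^ 2 ≠ 4) : M ≠ 1 ∧ M ≠ -1 := by
  constructor <;> rintro rfl <;> apply hM
  · simp [tr]; norm_num
  · simp [tr]; norm_num

lemma eq_or_eq_inv_of_commute {M k l : SL₂ K} (h2 : (2 : K) ≠ 0) (hM : tr M ^ 2 ≠ 4)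
    (hk : k * M = M * k) (hl : l * M = M * l) (htr : tr l = tr k) :
    l = k ∨ l = k⁻¹ := by
  obtain ⟨m1, m2⟩ := ne_one_of_trace hM
  obtain ⟨y, a1, a2, a3⟩ := exists_smul_of_commute m1 m2 hk
  obtain ⟨z, b1, b2, b3⟩ := exists_smul_of_commute m1 m2 hl
  have hd := discr_eq M
  have hdk := discr_eq k
  have hdl := discr_eq l
  rw [a1, a2, a3] at hdk
  rw [b1, b2, b3, htr] at hdl
  have hyz : z ^ 2 = y ^ 2 := by
    refine mul_right_cancel₀ (sub_ne_zero.2 hM) ?_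
    linear_combination hdl - hdk - (z ^ 2 - y ^ 2) * hd
  rw [tr, tr] at htr
  rcases sq_eq_sq_iff_eq_or_eq_neg.1 hyz with rfl | rfl
  · left
    refine eq_iff.2 ⟨mul_left_cancel₀ h2 ?_, by rw [a1, b1], by rw [a2, b2],
      mul_left_cancel₀ h2 ?_⟩
    · linear_combination htr + b3 - a3
    · linear_combination htr - b3 + a3
  · right
    simp only [eq_iff, entry_inv_zero_zero, entry_inv_zero_one, entry_inv_one_zero,
      entry_inv_one_one]
    refine ⟨mul_left_cancel₀ h2 ?_, ?_, ?_, mul_left_cancel₀ h2 ?_⟩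
    · linear_combination htr + b3 + a3
    · linear_combination b1 + a1
    · linear_combination b2 + a2
    · linear_combination htr - b3 - a3

/-- Powers of a matrix of determinant one with eigenvalues `ω` and `ω⁻¹`. -/
lemma smul_pow_eq {N : Matrix (Fin 2) (Fin 2) K} {ω : K} (hω : ω ≠ 0) (hdet : N.det = 1)
    (htr : N.trace = ω + ω⁻¹) (n : ℕ) :
    (ω - ω⁻¹) • N ^ n =
      (ω ^ n - ω⁻¹ ^ n) • N - (ω⁻¹ * ω ^ n - ω * ω⁻¹ ^ n) • (1 : Matrix (Fin 2) (Fin 2) K) := by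
  have hCH : N * N = (ω + ω⁻¹) • N - 1 := by
    rw [Matrix.det_fin_two] at hdet
    rw [Matrix.trace_fin_two] at htr
    rw [← htr]
    ext i j
    fin_cases i <;> fin_cases j <;> simp [Matrix.mul_apply, Fin.sum_univ_two] <;>
      first | linear_combination -hdet | ring1
  have hi : ω * ω⁻¹ = 1 := mul_inv_cancel₀ hω
  induction n with
  | zero => simp only [pow_zero, sub_self, zero_smul, mul_one]; module
  | succ n ih =>
    rw [pow_succ, ← smul_mul_assoc, ih, sub_mul, smul_mul_assoc, smul_mul_assoc, hCH, one_mul]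
    have e1 : ω⁻¹ * ω ^ (n + 1) = ω ^ n := by rw [pow_succ]; linear_combination ω ^ n * hi
    have e2 : ω * ω⁻¹ ^ (n + 1) = ω⁻¹ ^ n := by rw [pow_succ]; linear_combination ω⁻¹ ^ n * hi
    rw [e1, e2, smul_sub, smul_smul]
    have e3 : (ω ^ n - ω⁻¹ ^ n) * (ω + ω⁻¹) =
        (ω ^ (n + 1) - ω⁻¹ ^ (n + 1)) + (ω⁻¹ * ω ^ n - ω * ω⁻¹ ^ n) := by ring
    rw [e3]
    module

/-- In a finite field, the multipliers of an additive subgroup form a subfield. -/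
def multiplierSubfield [Finite K] (V : AddSubgroup K) : Subfield K where
  carrier := {e | ∀ y ∈ V, e * y ∈ V}
  mul_mem' ha hb y hy := by rw [mul_assoc]; exact ha _ (hb _ hy)
  one_mem' y hy := by rwa [one_mul]
  add_mem' ha hb y hy := by rw [add_mul]; exact V.add_mem (ha _ hy) (hb _ hy)
  zero_mem' y _ := by rw [zero_mul]; exact V.zero_mem
  neg_mem' ha y hy := by rw [neg_mul]; exact V.neg_mem (ha _ hy)
  inv_mem' e he := by
    cases nonempty_fintype K
    rcases eq_or_ne e 0 with rfl | h0
    · simp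
    have hpow : ∀ n : ℕ, ∀ y ∈ V, e ^ n * y ∈ V := fun n => by
      induction n with
      | zero => simp
      | succ n ih => intro y hy; rw [pow_succ, mul_assoc]; exact ih _ (he _ hy)
    have : e⁻¹ = e ^ (Fintype.card K - 2) := by
      refine inv_eq_of_mul_eq_one_left ?_
      rw [← pow_succ, ← FiniteField.pow_card_sub_one_eq_one e h0]
      congr 1
      have := Fintype.one_lt_card (α := K)
      omega
    rw [this]
    exact hpow _

lemma exists_multiplier_order [Finite K] {q : ℕ} (hq : Nat.card K = q ^ 2) {V : AddSubgroup K}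
    (hV : V ≠ ⊤) {x : K} (hx : x ∈ V) (hx0 : x ≠ 0) :
    ∃ m : ℕ, 0 < m ∧ m + 1 ≤ q ∧ m + 1 ≤ Nat.card V ∧
      ∀ e : K, e ≠ 0 → (∀ y ∈ V, e * y ∈ V) → e ^ m = 1 := by
  set E := multiplierSubfield V with hE
  cases nonempty_fintype K
  have : Fintype E := Fintype.ofFinite E
  have h1 : 1 < Nat.card E := Finite.one_lt_card
  have hfr : 2 ≤ Module.finrank E K := by
    have h0 : 0 < Module.finrank E K := Module.finrank_pos
    by_contra! hlt
    have hone : Module.finrank E K = 1 := by omega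
    apply hV
    rw [eq_top_iff]
    intro y _
    have hc := Module.card_eq_pow_finrank (K := E) (V := K)
    rw [hone, pow_one] at hc
    have hs : Function.Bijective (Subtype.val : E → K) :=
      (Fintype.bijective_iff_injective_and_card _).2 ⟨Subtype.val_injective, hc.symm⟩
    obtain ⟨⟨e, he⟩, hey⟩ := hs.2 (y / x)
    have : e * x ∈ V := he x hx
    rwa [show e = y / x from hey, div_mul_cancel₀ _ hx0] at this
  refine ⟨Nat.card E - 1, by omega, ?_, ?_, fun e he0 he => ?_⟩
  · rw [Nat.sub_add_cancel h1.le]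
    have hc := Module.natCard_eq_pow_finrank (K := E) (V := K)
    rw [hq] at hc
    by_contra! hlt
    have : q ^ 2 < Nat.card E ^ 2 := Nat.pow_lt_pow_left hlt (by norm_num)
    have := Nat.pow_le_pow_right (n := Nat.card E) (by omega) hfr
    omega
  · rw [Nat.sub_add_cancel h1.le]
    refine Nat.card_le_card_of_injective (fun e : E => (⟨e.1 * x, e.2 x hx⟩ : V)) fun a b h => ?_
    exact Subtype.ext (mul_right_cancel₀ hx0 (congrArg Subtype.val h))
  · have := FiniteField.pow_card_sub_one_eq_one (⟨e, he⟩ : E)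
      (fun h => he0 (congrArg Subtype.val h))
    rw [Nat.card_eq_fintype_card]
    simpa using congrArg Subtype.val this

/-- The subgroup of upper triangular matrices. -/
def borel (K : Type*) [Field K] : Subgroup (SL₂ K) where
  carrier := {g | entry g 1 0 = 0}
  mul_mem' {a b} ha hb := by
    have ha : entry a 1 0 = 0 := ha
    have hb : entry b 1 0 = 0 := hb
    simp [ha, hb]
  one_mem' := by simp
  inv_mem' {a} ha := by
    have ha : entry a 1 0 = 0 := ha
    simp [ha]

/-- The additive group of parameters of the upper unitriangular matrices in `H`. -/
def upperParams (H : Subgroup (SL₂ K)) : AddSubgroup K where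
  carrier := {y | upper y ∈ H}
  add_mem' ha hb := by simpa [upper_add] using H.mul_mem ha hb
  zero_mem' := by simp [upper_zero]
  neg_mem' ha := by simpa [upper_neg] using H.inv_mem ha

lemma mem_upperParams {H : Subgroup (SL₂ K)} {y : K} : y ∈ upperParams H ↔ upper y ∈ H := Iff.rfl

lemma conj_upper {g : SL₂ K} (hg : entry g 1 0 = 0) (y : K) :
    g * upper y * g⁻¹ = upper (entry g 0 0 ^ 2 * y) := by
  have hd := det_eq g
  rw [hg, mul_zero, sub_zero] at hd
  simp only [eq_iff, entry_mul, entry_upper, hg, entry_inv_zero_zero, entry_inv_zero_one,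
    entry_inv_one_zero, entry_inv_one_one, of_apply, cons_val', cons_val_zero, cons_val_one,
    cons_val_fin_one]
  refine ⟨by linear_combination hd, by ring, by ring, by linear_combination hd⟩

lemma inv_mul_eq_upper {g h : SL₂ K} (hg : entry g 1 0 = 0) (hh : entry h 1 0 = 0)
    (he : entry g 0 0 = entry h 0 0) : g⁻¹ * h = upper (entry (g⁻¹ * h) 0 1) := by
  have hd := det_eq g
  have hd' := det_eq h
  rw [hg, mul_zero, sub_zero] at hd
  rw [hh, mul_zero, sub_zero] at hd'
  simp only [eq_iff, entry_mul, entry_upper, hg, hh, entry_inv_zero_zero, entry_inv_zero_one,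
    entry_inv_one_zero, entry_inv_one_one, of_apply, cons_val', cons_val_zero, cons_val_one,
    cons_val_fin_one, true_and]
  refine ⟨by linear_combination hd - entry g 1 1 * he, by ring, by
    linear_combination hd' + entry h 1 1 * he⟩

lemma card_borel_le [Finite K] {H : Subgroup (SL₂ K)} {m : ℕ} (hm : 0 < m)
    (h : ∀ g ∈ H, entry g 1 0 = 0 → (entry g 0 0 ^ 2) ^ m = 1) :
    Nat.card ((borel K).subgroupOf H) ≤ Nat.card (upperParams H) * (2 * m) := by
  classical
  have : Fintype ((borel K).subgroupOf H) := Fintype.ofFinite _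
  cases nonempty_fintype K
  let f : (borel K).subgroupOf H → K := fun g => entry g.1.1 0 0
  have himg : Finset.univ.image f ⊆ (Polynomial.nthRoots (2 * m) (1 : K)).toFinset := by
    intro a ha
    obtain ⟨g, -, rfl⟩ := Finset.mem_image.1 ha
    rw [Multiset.mem_toFinset, Polynomial.mem_nthRoots (by omega), pow_mul]
    exact h _ g.1.2 g.2
  have hcard : (Finset.univ.image f).card ≤ 2 * m :=
    (Finset.card_le_card himg).trans
      ((Multiset.toFinset_card_le _).trans (Polynomial.card_nthRoots _ _))
  have hfib : ∀ a ∈ Finset.univ.image f,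
      (Finset.univ.filter fun x => f x = a).card ≤ Nat.card (upperParams H) := by
    intro a ha
    obtain ⟨g₀, -, rfl⟩ := Finset.mem_image.1 ha
    rw [Nat.subtype_card (Finset.univ.filter (· ∈ upperParams H)) (fun x => by simp)]
    have key : ∀ g : (borel K).subgroupOf H, f g = f g₀ →
        g₀.1.1⁻¹ * g.1.1 = upper (entry (g₀.1.1⁻¹ * g.1.1) 0 1) := fun g hg =>
      inv_mul_eq_upper g₀.2 g.2 hg.symm
    refine Finset.card_le_card_of_injOn (fun g => entry (g₀.1.1⁻¹ * g.1.1) 0 1) ?_ ?_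
    · intro g hg
      have hg' : f g = f g₀ := by simpa using hg
      have hmem : g₀.1.1⁻¹ * g.1.1 ∈ H := H.mul_mem (H.inv_mem g₀.1.2) g.1.2
      rw [key g hg'] at hmem
      simpa [mem_upperParams] using hmem
    · intro g hg k hk hgk
      have hg' : f g = f g₀ := by simpa using hg
      have hk' : f k = f g₀ := by simpa using hk
      have e : g₀.1.1⁻¹ * g.1.1 = g₀.1.1⁻¹ * k.1.1 := by
        rw [key g hg', key k hk']
        exact congrArg upper hgk
      exact Subtype.ext (Subtype.ext (mul_left_cancel e))
  rw [Nat.card_eq_fintype_card, ← Finset.card_univ]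
  exact (Finset.card_le_mul_card_image _ _ hfib).trans (Nat.mul_le_mul_left _ hcard)

lemma eq_top_of_upper_lower {H : Subgroup (SL₂ K)} (hu : ∀ x, upper x ∈ H)
    (hl : ∀ x, lower x ∈ H) : H = ⊤ := by
  have key : ∀ A : SL₂ K, entry A 1 0 ≠ 0 → A ∈ H := fun A hc => by
    have hd := det_eq A
    have : A = upper ((entry A 0 0 - 1) / entry A 1 0) * lower (entry A 1 0) *
        upper ((entry A 1 1 - 1) / entry A 1 0) := by
      simp [eq_iff]
      refine ⟨?_, ?_, ?_⟩ <;> field_simp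
      · ring
      · linear_combination -hd
      · ring
    rw [this]
    exact H.mul_mem (H.mul_mem (hu _) (hl _)) (hu _)
  refine (Subgroup.eq_top_iff' H).2 fun A => ?_
  by_cases hc : entry A 1 0 = 0
  · have hd := det_eq A
    have : A * lower 1 ∈ H := key _ fun h => by
      simp [hc] at h
      simp [hc, h] at hd
    simpa using H.mul_mem this (H.inv_mem (hl 1))
  · exact key A hc

lemma eq_top_of_upper {H : Subgroup (SL₂ K)} (hu : ∀ x, upper x ∈ H) {g : SL₂ K} (hg : g ∈ H)
    (hr : entry g 1 0 ≠ 0) : H = ⊤ := by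
  refine eq_top_of_upper_lower hu fun z => ?_
  set r := entry g 1 0 with hrdef
  set w := upper (-entry g 0 0 / r) * g * upper (-entry g 1 1 / r) with hw
  have hwH : w ∈ H := H.mul_mem (H.mul_mem (hu _) hg) (hu _)
  have hd := det_eq g
  rw [← hrdef] at hd
  have w00 : entry w 0 0 = 0 := by simp [hw, ← hrdef]; field_simp; ring
  have w01 : entry w 0 1 = -r⁻¹ := by
    simp [hw, ← hrdef]; field_simp; linear_combination -hd
  have w10 : entry w 1 0 = r := by simp [hw, ← hrdef]
  have w11 : entry w 1 1 = 0 := by simp [hw, ← hrdef]; field_simp; ring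
  have : lower z = w * upper (-z / r ^ 2) * w⁻¹ := by
    simp [eq_iff, w00, w01, w10, w11]
    field_simp
    simp
  rw [this]
  exact H.mul_mem (H.mul_mem hwH (hu _)) (H.inv_mem hwH)

/-- If the unitriangular matrices in `H` are not all of the unipotent group, then the diagonal
part of the upper triangular matrices in `H` is controlled by a proper subfield. -/
lemma exists_borel_exponent [Finite K] {q : ℕ} (hq : Nat.card K = q ^ 2) {H : Subgroup (SL₂ K)}
    (hV : upperParams H ≠ ⊤) {x : K} (hx : upper x ∈ H) (hx0 : x ≠ 0) :
    ∃ m : ℕ, 0 < m ∧ m + 1 ≤ q ∧ m + 1 ≤ Nat.card (upperParams H) ∧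
      ∀ g ∈ H, entry g 1 0 = 0 → (entry g 0 0 ^ 2) ^ m = 1 := by
  obtain ⟨m, hm, hmq, hmV, h⟩ := exists_multiplier_order hq hV (mem_upperParams.2 hx) hx0
  refine ⟨m, hm, hmq, hmV, fun g hg h0 => h _ (pow_ne_zero 2 fun h00 => ?_) fun y hy => ?_⟩
  · have hd := det_eq g
    simp [h0, h00] at hd
  · rw [mem_upperParams, ← conj_upper h0]
    exact H.mul_mem (H.mul_mem hg hy) (H.inv_mem hg)

/-- The key inequality: if `M ∈ H` has no eigenline which is `H`-conjugate to the standard one,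
its centralizer in `H` is small. -/
lemma orderOf_mul_lt [Finite K] (h2 : (2 : K) ≠ 0) {H : Subgroup (SL₂ K)} (hneg : -1 ∈ H)
    {M : SL₂ K} (hM : M ∈ H) (htr : tr M ^ 2 ≠ 4)
    (hMB : ∀ g ∈ H, entry (g⁻¹ * M * g) 1 0 ≠ 0) (hv : 2 ≤ Nat.card (upperParams H)) :
    (orderOf M : ℤ) * (2 * (Nat.card (upperParams H) - 1) - 2) <
      2 * Nat.card ((borel K).subgroupOf H) := by
  classical
  cases nonempty_fintype K
  have : Fintype H := Fintype.ofFinite H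
  obtain ⟨m1, m2⟩ := ne_one_of_trace htr
  set B := (borel K).subgroupOf H with hBdef
  have memB : ∀ g : H, g ∈ B ↔ entry g.1 1 0 = 0 := fun g => Iff.rfl
  set C : Subgroup H := Subgroup.centralizer {⟨M, hM⟩} with hC
  have memC : ∀ g : H, g ∈ C ↔ g.1 * M = M * g.1 := fun g => by
    rw [hC, Subgroup.mem_centralizer_singleton_iff, Subtype.ext_iff]
    rfl
  set Z : Finset H := {1, ⟨-1, hneg⟩} with hZ
  have memZ : ∀ g : H, g ∈ Z ↔ g.1 = 1 ∨ g.1 = -1 := fun g => by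
    rw [hZ, Finset.mem_insert, Finset.mem_singleton, Subtype.ext_iff, Subtype.ext_iff]
    rfl
  have ne11 : (1 : K) ≠ -1 := fun h => h2 (by linear_combination h)
  have neone : (1 : SL₂ K) ≠ -1 := fun h => ne11 (by simpa using (eq_iff.1 h).1)
  set D : Finset H := Finset.univ.filter fun g =>
    entry g.1 1 0 = 0 ∧ entry g.1 0 0 = entry g.1 1 1 ∧ entry g.1 0 1 ≠ 0 with hD
  have memD : ∀ g : H, g ∈ D ↔
    entry g.1 1 0 = 0 ∧ entry g.1 0 0 = entry g.1 1 1 ∧ entry g.1 0 1 ≠ 0 := fun g => by simp [hD]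
  have hZ2 : Z.card = 2 := by
    rw [hZ, Finset.card_pair]
    exact fun h => neone (congrArg Subtype.val h)
  have key := card_mul_card_sub_two_lt B C D Z ?_ ?_ ?_ ?_ ?_ ?_ ?_ ?_ ?_ ?_ ?_
  · have hMC : orderOf M ≤ Nat.card C := by
      rw [← Subgroup.orderOf_mk M hM]
      exact Nat.le_of_dvd Nat.card_pos (Subgroup.orderOf_dvd_natCard C ((memC _).2 rfl))
    have hDcard : 2 * (Nat.card (upperParams H) - 1 : ℤ) ≤ D.card := by
      have hcard : Nat.card (upperParams H) = Nat.card {y : upperParams H // y ≠ 0} + 1 := by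
        rw [← Finite.card_option, Nat.card_congr (Equiv.optionSubtypeNe 0)]
      let f : Z × {y : upperParams H // y ≠ 0} → D := fun a =>
        ⟨a.1.1 * ⟨upper a.2.1.1, a.2.1.2⟩, by
          have hy : a.2.1.1 ≠ 0 := fun h => a.2.2 (Subtype.ext h)
          rcases (memZ _).1 a.1.2 with h | h <;> simp [memD, h, hy]⟩
      have hf : Function.Injective f := by
        rintro ⟨⟨z, hz⟩, ⟨⟨y, hy⟩, hy0⟩⟩ ⟨⟨z', hz'⟩, ⟨⟨y', hy'⟩, hy0'⟩⟩ h
        have e : z.1 * upper y = z'.1 * upper y' := congrArg (fun d => d.1.1) h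
        have e' := eq_iff.1 e
        obtain ⟨rfl⟩ : z = z' := by
          apply Subtype.ext
          rcases (memZ z).1 hz with h | h <;> rcases (memZ z').1 hz' with h' | h' <;>
            simp [h, h', ne11, ne11.symm] at e' ⊢
        obtain rfl := upper_injective (mul_left_cancel e)
        rfl
      have hle := Nat.card_le_card_of_injective f hf
      rw [Nat.card_prod, Nat.card_eq_fintype_card (α := Z), Nat.card_eq_fintype_card (α := D),
        Fintype.card_coe, Fintype.card_coe, hZ2] at hle
      rw [hcard]
      push_cast
      rw [add_sub_cancel_right]
      exact_mod_cast hle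
    have h0 : (0 : ℤ) ≤ orderOf M := by positivity
    have hMC' : (orderOf M : ℤ) ≤ Nat.card C := by exact_mod_cast hMC
    have hv' : (2 : ℤ) ≤ Nat.card (upperParams H) := by exact_mod_cast hv
    calc (orderOf M : ℤ) * (2 * (Nat.card (upperParams H) - 1) - 2)
        ≤ orderOf M * (D.card - 2) := mul_le_mul_of_nonneg_left (by linarith) h0
      _ ≤ Nat.card C * (D.card - 2) := mul_le_mul_of_nonneg_right hMC' (by linarith)
      _ < 2 * Nat.card B := key
  · exact hZ2
  · intro z hz g
    rcases (memZ z).1 hz with h | h <;> (apply Subtype.ext; simp [h])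
  · intro z hz
    rcases (memZ z).1 hz with h | h <;> simp [memB, h]
  · intro z hz
    rcases (memZ z).1 hz with h | h <;> simp [memC, h]
  · rw [Finset.disjoint_left]
    intro z hz hz'
    have := ((memD z).1 hz').2.2
    rcases (memZ z).1 hz with h | h <;> simp [h] at this
  · exact fun d hd => (memB d).2 ((memD d).1 hd).1
  · intro h hh g₀ g₁ g₂
    rw [memZ, not_or] at hh
    exact eigenline_le_two hh.1 hh.2
  · intro h g₀ g₁ h₀ h₁
    obtain ⟨a, b, c⟩ := (memD _).1 h₀
    exact eigenline_le_one a b c h₁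
  · intro k hk hkZ g hkB
    rw [memZ, not_or] at hkZ
    exact hMB g.1 g.2 (eigenline_of_commute hkZ.1 hkZ.2 ((memC k).1 hk).symm hkB)
  · intro k hk hkZ g hg
    rw [memZ, not_or] at hkZ
    have e : k.1 * g.1 = g.1 * k.1 := by
      have := congrArg Subtype.val hg
      simp only [Subgroup.coe_mul, Subgroup.coe_inv] at this
      rw [mul_assoc, inv_mul_eq_iff_eq_mul] at this
      exact this
    exact (memC g).2 (commute_trans hkZ.1 hkZ.2 e.symm ((memC k).1 hk).symm)
  · intro k hk hkZ l hl hlZ g hg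
    have e : g.1⁻¹ * k.1 * g.1 = l.1 := congrArg Subtype.val hg
    have ht : tr l.1 = tr k.1 := by rw [← e, trace_conj]
    rcases eq_or_eq_inv_of_commute h2 htr ((memC k).1 hk) ((memC l).1 hl) ht with h | h
    · exact Or.inl (Subtype.ext h)
    · exact Or.inr (Subtype.ext h)

section Orders

variable {L : Type*} [Field L]

/-- Entrywise form of `smul_pow_eq`, with the eigenvalue in an extension field. -/
lemma entry_pow (φ : K →+* L) {M : SL₂ K} {ω : L} (hω : ω ≠ 0) (htr : φ (tr M) = ω + ω⁻¹)
    (n : ℕ) (i j : Fin 2) : (ω - ω⁻¹) * φ (entry (M ^ n) i j) =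
      (ω ^ n - ω⁻¹ ^ n) * φ (entry M i j) -
        (ω⁻¹ * ω ^ n - ω * ω⁻¹ ^ n) * (if i = j then 1 else 0) := by
  have h := smul_pow_eq (N := φ.mapMatrix M.1) hω
    (by rw [← RingHom.map_det, M.2, map_one])
    (by rw [← htr, Matrix.trace_fin_two, tr, map_add]; rfl) n
  rw [← map_pow] at h
  rw [← Matrix.one_apply]
  exact congrFun₂ h i j

lemma pow_eq_of_eigenvalue (φ : K →+* L) {M : SL₂ K} {ω : L} (hω : ω ≠ 0) (hω2 : ω ^ 2 ≠ 1)
    (htr : φ (tr M) = ω + ω⁻¹) {n : ℕ} {ε : K} (h : ω ^ n = φ ε) (hε : ε ^ 2 = 1) (i j : Fin 2) :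
    entry (M ^ n) i j = if i = j then ε else 0 := by
  have hs : ω - ω⁻¹ ≠ 0 := fun h => hω2 (by field_simp at h; linear_combination h)
  have hε' : (φ ε)⁻¹ = φ ε := by
    refine inv_eq_of_mul_eq_one_left ?_
    rw [← map_mul, ← sq, hε, map_one]
  refine φ.injective (mul_left_cancel₀ hs ?_)
  rw [entry_pow φ hω htr, inv_pow, h, hε']
  split_ifs <;> simp
  ring

lemma pow_eq_one_of_eigenvalue (φ : K →+* L) {M : SL₂ K} {ω : L} (hω : ω ≠ 0) (hω2 : ω ^ 2 ≠ 1)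
    (htr : φ (tr M) = ω + ω⁻¹) {n : ℕ} (h : ω ^ n = 1) : M ^ n = 1 := by
  have := pow_eq_of_eigenvalue φ hω hω2 htr (n := n) (ε := 1) (by simpa using h) (by simp)
  simp [eq_iff, this]

lemma pow_eq_neg_one_of_eigenvalue (φ : K →+* L) {M : SL₂ K} {ω : L} (hω : ω ≠ 0)
    (hω2 : ω ^ 2 ≠ 1) (htr : φ (tr M) = ω + ω⁻¹) {n : ℕ} (h : ω ^ n = -1) : M ^ n = -1 := by
  have := pow_eq_of_eigenvalue φ hω hω2 htr (n := n) (ε := -1) (by simpa using h) (by simp)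
  simp [eq_iff, this]

lemma eigenvalue_pow_eq_one (φ : K →+* L) {M : SL₂ K} {ω : L} (hω : ω ≠ 0) (hω2 : ω ^ 2 ≠ 1)
    (htr : φ (tr M) = ω + ω⁻¹) (hM : entry M 1 0 ≠ 0) {n : ℕ} (h : M ^ n = 1) : ω ^ n = 1 := by
  have h1 := entry_pow φ hω htr n 1 0
  have h2 := entry_pow φ hω htr n 0 0
  simp [h, hM] at h1 h2
  have hs : ω - ω⁻¹ ≠ 0 := fun h => hω2 (by field_simp at h; linear_combination h)
  refine mul_left_cancel₀ hs ?_
  linear_combination -h2 + (ω - φ (entry M 0 0)) * h1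

end Orders

/-- A generation criterion for `SL₂` over a field with `q ^ 2` elements. -/
theorem eq_top_of_orderOf [Finite K] {q : ℕ} (hq : Nat.card K = q ^ 2) (hqodd : Odd q)
    (h2 : (2 : K) ≠ 0) {H : Subgroup (SL₂ K)} (hneg : -1 ∈ H) {x : K}
    (hx : upper x ∈ H) (hx0 : x ≠ 0)
    {g : SL₂ K} (hg : g ∈ H) (hg0 : entry g 1 0 ≠ 0) {M : SL₂ K} (hM : M ∈ H)
    (htr : tr M ^ 2 ≠ 4) (h12 : 12 ≤ orderOf M) (hord : 10 * (q - 1) ≤ 3 * orderOf M) :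
    H = ⊤ := by
  by_cases hV : upperParams H = ⊤
  · exact eq_top_of_upper (fun y => (hV.symm ▸ AddSubgroup.mem_top y : y ∈ upperParams H)) hg hg0
  exfalso
  obtain ⟨m, hm, hmq, hmV, h⟩ := exists_borel_exponent hq hV hx hx0
  by_cases hMB : ∀ g ∈ H, entry (g⁻¹ * M * g) 1 0 ≠ 0
  · have h1 := orderOf_mul_lt h2 hneg hM htr hMB (by omega)
    have hb := card_borel_le hm h
    have hodd : Odd (Nat.card (upperParams H)) := by
      refine Odd.of_dvd_nat (n := Nat.card K) (hq ▸ hqodd.pow) ?_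
      exact AddSubgroup.card_addSubgroup_dvd_card _
    set v := Nat.card (upperParams H)
    set b := Nat.card ((borel K).subgroupOf H)
    set c := orderOf M
    zify at hb hmV h12 hm
    obtain ⟨k, hk⟩ := hodd
    have hc10 : 10 * (m : ℤ) ≤ 3 * c := by
      have : m ≤ q - 1 := by omega
      have : 10 * m ≤ 3 * c := by omega
      exact_mod_cast this
    have hk1 : 1 ≤ k := by omega
    rw [hk] at h1 hb hmV
    push_cast at *
    rcases hk1.eq_or_lt with rfl | hk2
    · push_cast at *
      linarith
    · have hk2 : (2 : ℤ) ≤ k := by exact_mod_cast hk2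
      nlinarith
  · push Not at hMB
    obtain ⟨g, hg, h0⟩ := hMB
    set N := g⁻¹ * M * g with hN
    have hNH : N ∈ H := H.mul_mem (H.mul_mem (H.inv_mem hg) hM) hg
    have hd := det_eq N
    rw [h0, mul_zero, sub_zero] at hd
    have h00 : entry N 0 0 ≠ 0 := left_ne_zero_of_mul_eq_one hd
    have htrN : tr M = entry N 0 0 + (entry N 0 0)⁻¹ := by
      rw [← trace_conj g M, ← hN, tr, eq_inv_of_mul_eq_one_right hd]
    have hpow := h N hNH h0
    rw [← pow_mul] at hpow
    have := pow_eq_one_of_eigenvalue (RingHom.id K) h00 (fun h2 => htr ?_) htrN hpow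
    · have := Nat.le_of_dvd (by omega) (orderOf_dvd_of_pow_eq_one this)
      omega
    · have : (entry N 0 0)⁻¹ = entry N 0 0 := inv_eq_of_mul_eq_one_left (by rw [← sq, h2])
      rw [htrN, this]
      linear_combination 4 * h2

lemma ringChar_ne_two (h2 : (2 : K) ≠ 0) : ringChar K ≠ 2 := fun h => h2 <| by
  have := ringChar.Nat.cast_ringChar (R := K)
  rwa [h] at this

lemma trace_sq_ne_four {L : Type*} [Field L] (φ : K →+* L) {t : K} {ω : L} (hω : ω ≠ 0)
    (hω2 : ω ^ 2 ≠ 1) (ht : φ t = ω + ω⁻¹) : t ^ 2 ≠ 4 := fun h => by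
  have h' := congrArg φ h
  rw [map_pow, ht, map_ofNat] at h'
  have : (ω ^ 2 - 1) ^ 2 = 0 := by
    field_simp at h'
    linear_combination h'
  exact hω2 (sub_eq_zero.1 (pow_eq_zero_iff two_ne_zero |>.1 this))

lemma tr_upper_mul_lower (x z : K) : tr (upper x * lower z) = 2 + x * z := by
  simp [tr]; ring

/-- A pair of unitriangular matrices generates, provided its product has large order. -/
lemma closure_upper_lower_eq_top [Finite K] {q : ℕ} (hq : Nat.card K = q ^ 2) (hqodd : Odd q)
    (h2 : (2 : K) ≠ 0) {L : Type*} [Field L] (φ : K →+* L) {ω : L} (hω : ω ≠ 0) (hω2 : ω ^ 2 ≠ 1)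
    {n : ℕ} (hωn : ω ^ n = -1) {x z : K} (hx : x ≠ 0) (hz : z ≠ 0)
    (ht : φ (2 + x * z) = ω + ω⁻¹) (h12 : 12 ≤ orderOf ω) (hord : 10 * (q - 1) ≤ 3 * orderOf ω) :
    Subgroup.closure ({upper x, lower z} : Set (SL₂ K)) = ⊤ := by
  rw [← tr_upper_mul_lower] at ht
  have hA : upper x ∈ Subgroup.closure ({upper x, lower z} : Set (SL₂ K)) :=
    Subgroup.subset_closure (by simp)
  have hB : lower z ∈ Subgroup.closure ({upper x, lower z} : Set (SL₂ K)) :=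
    Subgroup.subset_closure (by simp)
  have hM := Subgroup.mul_mem _ hA hB
  have hle : orderOf ω ≤ orderOf (upper x * lower z) :=
    Nat.le_of_dvd (orderOf_pos _) (orderOf_dvd_of_pow_eq_one
      (eigenvalue_pow_eq_one φ hω hω2 ht (by simpa using hz) (pow_orderOf_eq_one _)))
  refine eq_top_of_orderOf hq hqodd h2 ?_ hA hx hB (by simpa using hz) hM
    (trace_sq_ne_four φ hω hω2 ht) (h12.trans hle) (by omega)
  rw [← pow_eq_neg_one_of_eigenvalue φ hω hω2 ht hωn]
  exact Subgroup.pow_mem _ hM n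

/-- The exceptional generation statement over the field with 25 elements. -/
lemma closure_upper_lower_eq_top_of_card_eq [Finite K] (hq : Nat.card K = 5 ^ 2) {l : K}
    (hl : l ^ 2 - l + 1 = 0) :
    Subgroup.closure ({upper 1, lower l} : Set (SL₂ K)) = ⊤ := by
  cases nonempty_fintype K
  have h5 : (5 : K) = 0 := by
    have := Nat.cast_card_eq_zero K
    rw [← Nat.card_eq_fintype_card, hq] at this
    exact pow_eq_zero_iff two_ne_zero |>.1 (by exact_mod_cast this)
  have h1 : (1 : K) ≠ 0 := one_ne_zero
  have hl0 : l ≠ 0 := by rintro rfl; simp at hl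
  set H := Subgroup.closure ({upper 1, lower l} : Set (SL₂ K)) with hH
  have hA : upper 1 ∈ H := Subgroup.subset_closure (by simp)
  have hB : lower l ∈ H := Subgroup.subset_closure (by simp)
  by_cases hV : upperParams H = ⊤
  · exact eq_top_of_upper (fun y => (hV.symm ▸ AddSubgroup.mem_top y : y ∈ upperParams H)) hB
      (by simpa using hl0)
  exfalso
  obtain ⟨m, hm, hmq, -, h⟩ := exists_borel_exponent hq hV hA h1
  set W := lower l * upper 1 * lower l ^ 4 * upper 1 ^ 4 * lower l ^ 3 with hW
  have hWH : W ∈ H := H.mul_mem (H.mul_mem (H.mul_mem (H.mul_mem hB hA) (H.pow_mem hB 4))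
    (H.pow_mem hA 4)) (H.pow_mem hB 3)
  have e10 : entry W 1 0 = 0 := by
    simp [hW, lower_pow, upper_pow]
    linear_combination (115 + 48 * l) * hl + (-23 + 15 * l) * h5
  have e00 : entry W 0 0 ^ 2 = l := by
    simp [hW, lower_pow, upper_pow]
    linear_combination (2281 + 4128 * l + 2304 * l ^ 2) * hl + (-456 - 362 * l) * h5
  have hlm := h W hWH e10
  rw [e00] at hlm
  have hm5 : m < 5 := by omega
  interval_cases m
  · exact h1 (by linear_combination hl - l * hlm)
  · exact h1 (by linear_combination 2 * (2 + l) * hl + (2 - 2 * (2 + l)) * hlm - h5)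
  · exact h1 (by linear_combination 3 * (l + 1) * hl - 3 * hlm - h5)
  · exact h1 (by linear_combination (2 - 2 * (l - 2) * (l * (l + 1))) * hl + 2 * (l - 2) * hlm - h5)

lemma mem_range_of_pow_card [Fintype K] {L : Type*} [Field L] [Algebra K L] {x : L}
    (h : x ^ Fintype.card K = x) : ∃ s : K, algebraMap K L s = x := by
  open Polynomial in
  have hs : (X ^ Fintype.card K - X : K[X]).Splits := by
    rw [splits_iff_card_roots, FiniteField.roots_X_pow_card_sub_X,
      FiniteField.X_pow_card_sub_X_natDegree_eq _ Fintype.one_lt_card]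
    rfl
  have hr := hs.roots_map (algebraMap K L)
  have hne : (X ^ Fintype.card K - X : L[X]) ≠ 0 :=
    FiniteField.X_pow_card_sub_X_ne_zero L Fintype.one_lt_card
  have hx : x ∈ (X ^ Fintype.card K - X : L[X]).roots := by
    rw [mem_roots hne]
    simp [h]
  rw [Polynomial.map_sub, Polynomial.map_pow, Polynomial.map_X] at hr
  rw [hr, Multiset.mem_map] at hx
  obtain ⟨s, -, hs⟩ := hx
  exact ⟨s, hs⟩

/-- Integers are squares in a field with `q ^ 2` elements. -/
lemma isSquare_natCast [Fintype K] {p e : ℕ} (hp : p.Prime) (hodd : Odd p)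
    (hK : Fintype.card K = (p ^ e) ^ 2) [CharP K p] (n : ℕ) : IsSquare (n : K) := by
  have : Fact p.Prime := ⟨hp⟩
  rcases eq_or_ne (n : K) 0 with h0 | h0
  · rw [h0]; exact IsSquare.zero
  have hchar : ringChar K ≠ 2 := by
    rw [ringChar.eq K p]
    rintro rfl
    exact absurd hodd (by decide)
  rw [FiniteField.isSquare_iff hchar h0]
  have h1 : (n : K) ^ (p - 1) = 1 := by
    have hz : (n : ZMod p) ≠ 0 := fun h => h0 (by
      simpa using congrArg (ZMod.castHom (dvd_refl p) K) h)
    simpa using congrArg (ZMod.castHom (dvd_refl p) K) (ZMod.pow_card_sub_one_eq_one hz)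
  have hdvd : p - 1 ∣ Fintype.card K / 2 := by
    obtain ⟨c, hc⟩ := Nat.sub_one_dvd_pow_sub_one p e
    obtain ⟨k, hk⟩ := hodd.pow (n := e)
    refine ⟨c * (k + 1), ?_⟩
    rw [hK, ← mul_assoc, ← hc, hk]
    have : (2 * k + 1) ^ 2 = 2 * (2 * k * (k + 1)) + 1 := by ring
    rw [this]
    simp
    omega
  obtain ⟨c, hc⟩ := hdvd
  rw [hc, pow_mul, h1, one_pow]

lemma isSquare_neg_one [Fintype K] {q : ℕ} (hq : Odd q) (hK : Fintype.card K = q ^ 2) :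
    IsSquare (-1 : K) := by
  rw [FiniteField.isSquare_neg_one_iff, hK]
  obtain ⟨k, rfl⟩ := hq
  have : (2 * k + 1) ^ 2 = 4 * (k * (k + 1)) + 1 := by ring
  omega

/-- The split generating pair. -/
lemma exists_split_pair [Fintype K] {q : ℕ} (hK : Fintype.card K = q ^ 2) (hqodd : Odd q)
    (hq : 3 < q) (h2 : (2 : K) ≠ 0) :
    ∃ d : K, d ≠ 0 ∧ Subgroup.closure ({upper 1, lower (d ^ 2)} : Set (SL₂ K)) = ⊤ ∧
      (upper 1 * lower (d ^ 2) : SL₂ K) ^ ((q ^ 2 - 1) / 4) = -1 := by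
  classical
  obtain ⟨k, hk⟩ := hqodd
  obtain ⟨j, hj⟩ : 2 ∣ k * (k + 1) := (Nat.even_mul_succ_self k).two_dvd
  have hq2 : q ^ 2 = 8 * j + 1 := by rw [hk]; linear_combination 4 * hj
  have hj3 : 3 ≤ j := by
    have := Nat.mul_le_mul (show 2 ≤ k by omega) (show 3 ≤ k + 1 by omega)
    omega
  obtain ⟨β, hβ⟩ := IsCyclic.exists_ofOrder_eq_natCard (α := Kˣ)
  have hβ' : orderOf (β : K) = 8 * j := by
    rw [orderOf_units, hβ, Nat.card_eq_fintype_card, Fintype.card_units, hK, hq2]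
    rfl
  have hβ0 : (β : K) ≠ 0 := β.ne_zero
  generalize (β : K) = b at hβ' hβ0
  have hb2 : b ^ 2 ≠ 1 := fun h => by
    have := Nat.le_of_dvd (by norm_num) (orderOf_dvd_of_pow_eq_one h)
    omega
  have hneg : (b ^ 2) ^ ((q ^ 2 - 1) / 4) = -1 := by
    have hsq : (b ^ (4 * j)) ^ 2 = 1 := by
      rw [← pow_mul, show 4 * j * 2 = 8 * j by ring, ← hβ', pow_orderOf_eq_one]
    have hne : b ^ (4 * j) ≠ 1 := fun h => by
      have := Nat.le_of_dvd (by omega) (orderOf_dvd_of_pow_eq_one h)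
      omega
    rw [← pow_mul, show 2 * ((q ^ 2 - 1) / 4) = 4 * j by omega]
    exact (mul_self_eq_one_iff.1 ((sq _).symm.trans hsq)).resolve_left hne
  have hord : orderOf (b ^ 2) = 4 * j := by
    rw [orderOf_pow' _ two_ne_zero, hβ', show 8 * j = (4 * j) * 2 by ring, Nat.gcd_mul_left_left]
    simp
  have hα2 : (b ^ 2) ^ 2 ≠ 1 := fun h => by
    have := Nat.le_of_dvd (by norm_num) (orderOf_dvd_of_pow_eq_one h)
    omega
  have hd : b - b⁻¹ ≠ 0 := fun h => hb2 (by field_simp at h; linear_combination h)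
  have ht : RingHom.id K (2 + 1 * (b - b⁻¹) ^ 2) = b ^ 2 + (b ^ 2)⁻¹ := by
    simp; field_simp; ring
  refine ⟨b - b⁻¹, hd, ?_, ?_⟩
  · rcases Nat.lt_or_ge q 7 with h7 | h7
    · obtain rfl : q = 5 := by omega
      obtain rfl : j = 3 := by omega
      apply closure_upper_lower_eq_top_of_card_eq (by rw [Nat.card_eq_fintype_card, hK])
      have h5 : (5 : K) = 0 := by
        have := Nat.cast_card_eq_zero K
        rw [hK] at this
        exact pow_eq_zero_iff two_ne_zero |>.1 (by exact_mod_cast this)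
      have hneg' : b ^ 12 = -1 := by
        rw [← hneg]
        norm_num [← pow_mul]
      have h4 : b ^ 4 + 1 ≠ 0 := fun h => by
        have := Nat.le_of_dvd (by norm_num) (orderOf_dvd_of_pow_eq_one
          (show b ^ 8 = 1 by linear_combination (b ^ 4 - 1) * h))
        omega
      have h8 : b ^ 8 - b ^ 4 + 1 = 0 :=
        (mul_eq_zero.1 (by linear_combination hneg')).resolve_left h4
      field_simp
      linear_combination h8 - b ^ 2 * (b ^ 2 - 1) ^ 2 * h5
    · refine closure_upper_lower_eq_top (by rw [Nat.card_eq_fintype_card, hK]) ⟨k, hk⟩ h2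
        (RingHom.id K) (pow_ne_zero 2 hβ0) hα2 hneg one_ne_zero (pow_ne_zero 2 hd) ht
        (by omega) ?_
      rw [hord]
      obtain ⟨r, rfl⟩ : ∃ r, q = r + 1 := ⟨q - 1, by omega⟩
      rw [Nat.add_sub_cancel]
      nlinarith
  · refine pow_eq_neg_one_of_eigenvalue (RingHom.id K) (pow_ne_zero 2 hβ0) hα2 ?_ hneg
    rw [tr_upper_mul_lower, ht]

/-- The nonsplit generating pair. -/
lemma exists_nonsplit_pair [Fintype K] {q : ℕ} (hK : Fintype.card K = q ^ 2) (hqodd : Odd q)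
    (hq : 3 < q) (h2 : (2 : K) ≠ 0) {ν : K} (hν : ν ≠ 0) :
    ∃ d : K, d ≠ 0 ∧ Subgroup.closure ({upper ν, lower (d ^ 2 / ν)} : Set (SL₂ K)) = ⊤ ∧
      (upper ν * lower (d ^ 2 / ν) : SL₂ K) ^ ((q ^ 2 + 1) / 2) = -1 := by
  obtain ⟨k, hk⟩ := id hqodd
  have hQ : q ^ 2 = 2 * (2 * (k * (k + 1))) + 1 := by rw [hk]; ring
  obtain ⟨i, hi⟩ := isSquare_neg_one hqodd hK
  set N := (q ^ 2 + 1) / 2 with hN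
  have hNN : 2 * N = q ^ 2 + 1 := by omega
  have hNodd : Odd N := ⟨k * (k + 1), by omega⟩
  have hN13 : 12 ≤ N := by
    have := Nat.mul_le_mul (show 2 ≤ k by omega) (show 3 ≤ k + 1 by omega)
    omega
  obtain ⟨L, _, _, η, hη⟩ : ∃ (L : Type _) (_ : Field L) (_ : Algebra K L) (η : L),
      IsPrimitiveRoot η N := by
    have hne : NeZero (N : AlgebraicClosure K) := ⟨fun h => by
      have h1 : ((2 * N : ℕ) : AlgebraicClosure K) = 0 := by rw [Nat.cast_mul, h, mul_zero]
      have h3 : ((q ^ 2 : ℕ) : AlgebraicClosure K) = 0 := by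
        rw [← hK, ← map_natCast (algebraMap K (AlgebraicClosure K)), Nat.cast_card_eq_zero,
          map_zero]
      rw [hNN, Nat.cast_add, h3] at h1
      simp at h1⟩
    obtain ⟨η, hη⟩ := HasEnoughRootsOfUnity.exists_primitiveRoot (AlgebraicClosure K) N
    exact ⟨_, _, inferInstance, η, hη⟩
  have hη0 : η ≠ 0 := hη.ne_zero (by omega)
  have hηQ : η ^ Fintype.card K = η⁻¹ := by
    refine eq_inv_of_mul_eq_one_left ?_
    rw [← pow_succ, hK, ← hNN, mul_comm, pow_mul, hη.pow_eq_one, one_pow]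
  obtain ⟨s, hs⟩ : ∃ s : K, algebraMap K L s = η + η⁻¹ := by
    apply mem_range_of_pow_card
    have := map_add (FiniteField.frobeniusAlgHom K L) η η⁻¹
    simp only [FiniteField.coe_frobeniusAlgHom, inv_pow, hηQ, inv_inv] at this
    rw [this, add_comm]
  have ho : orderOf η = N := hη.eq_orderOf.symm
  have hη4 : η ^ 4 ≠ 1 := fun h => by
    have := Nat.le_of_dvd (by norm_num) (orderOf_dvd_of_pow_eq_one h)
    omega
  have hs0 : s ≠ 0 := fun h => hη4 (by
    rw [h, map_zero] at hs
    field_simp at hs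
    linear_combination (1 - η ^ 2) * hs)
  have hi0 : i ≠ 0 := by rintro rfl; simp at hi
  have hω2 : (-η ^ 2) ^ 2 ≠ 1 := fun h => hη4 (by linear_combination h)
  have hω0 : -η ^ 2 ≠ 0 := neg_ne_zero.2 (pow_ne_zero 2 hη0)
  have hωN : (-η ^ 2) ^ N = -1 := by
    rw [hNodd.neg_pow, ← pow_mul, mul_comm, pow_mul, hη.pow_eq_one, one_pow]
  have ht : algebraMap K L (2 + ν * ((i * s) ^ 2 / ν)) = -η ^ 2 + (-η ^ 2)⁻¹ := by
    have : 2 + ν * ((i * s) ^ 2 / ν) = 2 - s ^ 2 := by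
      field_simp
      linear_combination -s ^ 2 * hi
    rw [this, map_sub, map_pow, hs, map_ofNat]
    field_simp
    ring
  have hord : 2 * N ≤ orderOf (-η ^ 2) := by
    have hpos : 0 < orderOf (-η ^ 2) := by
      refine orderOf_pos_iff.2 (isOfFinOrder_iff_pow_eq_one.2 ⟨2 * N, by omega, ?_⟩)
      rw [mul_comm, pow_mul, hωN]
      ring
    have hdvd : N ∣ orderOf (-η ^ 2) := by
      have h4 : orderOf (η ^ 4) = N := by
        rw [orderOf_pow' _ four_ne_zero, ho, Nat.Coprime.gcd_eq_one, Nat.div_one]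
        exact (Nat.Coprime.pow_right 2 hNodd.coprime_two_right : Nat.Coprime N (2 ^ 2))
      rw [← h4, show η ^ 4 = (-η ^ 2) ^ 2 by ring]
      exact orderOf_pow_dvd 2
    obtain ⟨c, hc⟩ := hdvd
    have hc0 : c ≠ 0 := by rintro rfl; omega
    have hc1 : c ≠ 1 := by
      rintro rfl
      have h1 := pow_orderOf_eq_one (-η ^ 2)
      rw [hc, mul_one, hωN] at h1
      have : algebraMap K L 2 = 0 := by rw [map_ofNat]; linear_combination -h1
      exact h2 ((map_eq_zero _).1 this)
    rw [hc, mul_comm]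
    exact Nat.mul_le_mul_left _ (by omega)
  refine ⟨i * s, mul_ne_zero hi0 hs0, ?_, ?_⟩
  · refine closure_upper_lower_eq_top (by rw [Nat.card_eq_fintype_card, hK]) hqodd h2
      (algebraMap K L) hω0 hω2 hωN hν (div_ne_zero (pow_ne_zero 2 (mul_ne_zero hi0 hs0)) hν) ht
      (by omega) ?_
    obtain ⟨r, rfl⟩ : ∃ r, q = r + 1 := ⟨q - 1, by omega⟩
    rw [Nat.add_sub_cancel]
    nlinarith
  · refine pow_eq_neg_one_of_eigenvalue (algebraMap K L) hω0 hω2 ?_ hωN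
    rw [tr_upper_mul_lower, ht]

lemma neg_one_mem_center : (-1 : SL₂ K) ∈ Subgroup.center (SL₂ K) :=
  Subgroup.mem_center_iff.2 fun g => by simp

lemma mem_center_iff {A : SL₂ K} : A ∈ Subgroup.center (SL₂ K) ↔ A = 1 ∨ A = -1 := by
  refine ⟨fun h => ?_, ?_⟩
  · have hu := eq_iff.1 (Subgroup.mem_center_iff.1 h (upper 1))
    have hl := eq_iff.1 (Subgroup.mem_center_iff.1 h (lower 1))
    simp at hu hl
    refine eq_one_or_neg_one hl.1 hu.1 ?_
    linear_combination hl.2.1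
  · rintro (rfl | rfl)
    exacts [one_mem _, neg_one_mem_center]

lemma upper_notMem_center {x : K} (hx : x ≠ 0) : upper x ∉ Subgroup.center (SL₂ K) := fun h => by
  rcases mem_center_iff.1 h with h | h <;> simpa [hx] using (eq_iff.1 h).2.1

lemma lower_notMem_center {x : K} (hx : x ≠ 0) : lower x ∉ Subgroup.center (SL₂ K) := fun h => by
  rcases mem_center_iff.1 h with h | h <;> simpa [hx] using (eq_iff.1 h).2.2.1

lemma orderOf_mk_of_pow_eq_one {p : ℕ} (hp : p.Prime) {A : SL₂ K} (h : A ^ p = 1)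
    (hA : A ∉ Subgroup.center (SL₂ K)) : orderOf (QuotientGroup.mk A : PSL2 K) = p := by
  have : Fact p.Prime := ⟨hp⟩
  refine orderOf_eq_prime ?_ fun h1 => hA ((QuotientGroup.eq_one_iff _).1 h1)
  rw [← QuotientGroup.mk_pow, h, QuotientGroup.mk_one]

lemma upper_pow_char (p : ℕ) [CharP K p] (x : K) : upper x ^ p = 1 := by
  rw [upper_pow, CharP.cast_eq_zero, zero_mul, upper_zero]

lemma lower_pow_char (p : ℕ) [CharP K p] (x : K) : lower x ^ p = 1 := by
  rw [lower_pow, CharP.cast_eq_zero, zero_mul]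
  simp [eq_iff]

/-- Conjugate unitriangular elements of `PSL₂` have parameters in the same square class. -/
lemma eq_mul_sq_of_conj (h2 : (2 : K) ≠ 0) {y y' : K} {g : PSL2 K}
    (h : g * QuotientGroup.mk (upper y) * g⁻¹ = (QuotientGroup.mk (upper y') : PSL2 K)) :
    ∃ a, y' = y * a ^ 2 := by
  obtain ⟨g, rfl⟩ := QuotientGroup.mk_surjective g
  rw [← QuotientGroup.mk_inv, ← QuotientGroup.mk_mul, ← QuotientGroup.mk_mul,
    QuotientGroup.eq, mem_center_iff, inv_mul_eq_one, inv_mul_eq_iff_eq_mul, mul_neg_one] at h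
  have htr := trace_conj g⁻¹ (upper y)
  rw [inv_inv] at htr
  have hU : g * upper y * g⁻¹ = upper y' := by
    refine h.resolve_right fun h => ?_
    rw [← neg_neg (g * upper y * g⁻¹), ← h] at htr
    simp [tr] at htr
    exact mul_ne_zero h2 h2 (by linear_combination -htr)
  refine ⟨entry g 0 0, ?_⟩
  have := (eq_iff.1 hU).2.1
  simp at this
  linear_combination -this

/-- The unipotent elements of `PSL₂` with parameter in the square class of `ν`. -/
def unipotentClass (ν : K) : Set (PSL2 K) :=
  {x | ∃ (g : PSL2 K) (r : K), x = g * QuotientGroup.mk (upper (ν * r ^ 2)) * g⁻¹}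

lemma conjPowers_upper_subset {x ν : K} (h : ∀ n : ℕ, ∃ r, n * x = ν * r ^ 2) :
    conjPowers (QuotientGroup.mk (upper x) : PSL2 K) ⊆ unipotentClass ν := by
  rintro _ ⟨g, j, rfl⟩
  obtain ⟨r, hr⟩ := h j
  exact ⟨g, r, by rw [← hr, ← upper_pow, QuotientGroup.mk_pow]⟩

lemma conjPowers_lower_subset {x ν : K} (h : ∀ n : ℕ, ∃ r, -(n * x) = ν * r ^ 2) :
    conjPowers (QuotientGroup.mk (lower x) : PSL2 K) ⊆ unipotentClass ν := by
  rintro _ ⟨g, j, rfl⟩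
  obtain ⟨r, hr⟩ := h j
  refine ⟨g * QuotientGroup.mk weyl, r, ?_⟩
  rw [← hr, ← QuotientGroup.mk_pow, lower_pow, lower_eq_conj]
  simp only [QuotientGroup.mk_mul, QuotientGroup.mk_inv, _root_.mul_inv_rev, mul_assoc]

lemma unipotentClass_inter (h2 : (2 : K) ≠ 0) {ν : K} (hν : ¬ IsSquare ν) :
    unipotentClass (1 : K) ∩ unipotentClass ν ⊆ {1} := by
  rintro x ⟨⟨g, r, rfl⟩, ⟨g', r', h⟩⟩
  have h' : (g'⁻¹ * g) * QuotientGroup.mk (upper (1 * r ^ 2)) * (g'⁻¹ * g)⁻¹ =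
      (QuotientGroup.mk (upper (ν * r' ^ 2)) : PSL2 K) := by
    have := congrArg (fun z => g'⁻¹ * z * g') h
    simpa [mul_assoc] using this
  obtain ⟨a, ha⟩ := eq_mul_sq_of_conj h2 h'
  have hr : r' = 0 := by
    by_contra hr
    refine hν ⟨r * a / r', ?_⟩
    field_simp
    linear_combination ha
  rw [h, hr]
  simp [upper_zero]

lemma unipotentClass_pow (p : ℕ) [CharP K p] {ν : K} {x : PSL2 K} (hx : x ∈ unipotentClass ν) :
    x ^ p = 1 := by
  obtain ⟨g, r, rfl⟩ := hx
  rw [conj_pow, ← QuotientGroup.mk_pow, upper_pow_char]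
  simp

end SL2

lemma pow_eq_one_of_mem_conjPowers {G : Type*} [Group G] {a x : G} (hx : x ∈ conjPowers a) {n : ℕ}
    (ha : a ^ n = 1) : x ^ n = 1 := by
  obtain ⟨g, j, rfl⟩ := hx
  rw [conj_pow, ← pow_mul, mul_comm, pow_mul, ha]
  simp

lemma one_mem_sigma3 {G : Type*} [Group G] (a b c : G) : 1 ∈ sigma3 a b c :=
  Or.inl (Or.inl ⟨1, 0, by simp⟩)

lemma eq_one_of_pow_of_coprime {G : Type*} [Group G] {x : G} {m n : ℕ} (h : m.Coprime n)
    (hm : x ^ m = 1) (hn : x ^ n = 1) : x = 1 :=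
  orderOf_eq_one_iff.1 (Nat.eq_one_of_dvd_coprimes h (orderOf_dvd_of_pow_eq_one hm)
    (orderOf_dvd_of_pow_eq_one hn))

lemma closure_mk_eq_top {G : Type*} [Group G] (N : Subgroup G) [N.Normal] {a b : G}
    (h : Subgroup.closure ({a, b} : Set G) = ⊤) :
    Subgroup.closure ({QuotientGroup.mk a, QuotientGroup.mk b} : Set (G ⧸ N)) = ⊤ := by
  have := MonoidHom.map_closure (QuotientGroup.mk' N) {a, b}
  rw [h, ← MonoidHom.range_eq_map, QuotientGroup.range_mk', Set.image_pair] at this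
  exact this.symm

open SL2 in
/-- Let `3 < q = p ^ e` with `p` an odd prime.  Then `PSL₂(q²)` admits an
unmixed Beauville structure of type `((p, p, t₁), (p, p, t₂))` for some `t₁ ∣ (q² - 1)/2`
and `t₂ ∣ (q² + 1)/2`. -/
theorem beauville_ppt_PSL2_sq (p e : ℕ) (hp : p.Prime) (hodd : Odd p) (he : 0 < e)
    (hq : 3 < p ^ e)
    (K : Type*) [Field K] [Fintype K] (hK : Fintype.card K = (p ^ e) ^ 2) :
    ∃ t₁ t₂ : ℕ, t₁ ∣ ((p ^ e) ^ 2 - 1) / 2 ∧ t₂ ∣ ((p ^ e) ^ 2 + 1) / 2 ∧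
      HasBeauvilleOfType (PSL2 K) p p t₁ p p t₂ := by
  have hqodd : Odd (p ^ e) := hodd.pow
  have : Fact p.Prime := ⟨hp⟩
  have hchar : CharP K p := by
    rw [← pow_mul] at hK
    exact charP_of_card_eq_prime_pow hK
  have h2 : (2 : K) ≠ 0 := fun h => by
    have : p ∣ 2 := (CharP.cast_eq_zero_iff K p 2).1 (by exact_mod_cast h)
    rw [(Nat.prime_dvd_prime_iff_eq hp Nat.prime_two).1 this] at hodd
    exact absurd hodd (by decide)
  obtain ⟨ν, hν⟩ := FiniteField.exists_nonsquare (ringChar_ne_two h2)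
  have hν0 : ν ≠ 0 := by rintro rfl; exact hν IsSquare.zero
  obtain ⟨d₁, hd₁, htop₁, hpow₁⟩ := exists_split_pair hK hqodd hq h2
  obtain ⟨d₂, hd₂, htop₂, hpow₂⟩ := exists_nonsplit_pair hK hqodd hq h2 hν0
  have hm₁ : (4 : ℕ) ∣ (p ^ e) ^ 2 - 1 := by
    obtain ⟨k, hk⟩ := hqodd
    refine ⟨k * (k + 1), ?_⟩
    rw [hk, show (2 * k + 1) ^ 2 = 4 * (k * (k + 1)) + 1 by ring, Nat.add_sub_cancel]
  set Q := (p ^ e) ^ 2 with hQ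
  have hQodd : Odd Q := hqodd.pow
  have hQ1 : 1 ≤ Q := hQodd.pos
  let π : Matrix.SpecialLinearGroup (Fin 2) K → PSL2 K := QuotientGroup.mk
  have hc {A : Matrix.SpecialLinearGroup (Fin 2) K} {n : ℕ} (h : A ^ n = -1) :
      ((π A)⁻¹) ^ n = 1 := by
    rw [inv_pow, inv_eq_one]
    exact (QuotientGroup.eq_one_iff (A ^ n)).2 (by rw [h]; exact neg_one_mem_center)
  have hc₁ : (π (upper 1 * lower (d₁ ^ 2)))⁻¹ ^ ((Q - 1) / 2) = 1 := by
    obtain ⟨m, hm⟩ := hm₁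
    rw [show (Q - 1) / 2 = (Q - 1) / 4 * 2 by omega, pow_mul, hc hpow₁, one_pow]
  have hc₂ : (π (upper ν * lower (d₂ ^ 2 / ν)))⁻¹ ^ ((Q + 1) / 2) = 1 := hc hpow₂
  have hdd₁ := pow_ne_zero 2 hd₁
  have hdd₂ := div_ne_zero (pow_ne_zero 2 hd₂) hν0
  obtain ⟨i, hi⟩ := isSquare_neg_one hqodd hK
  have hsub₁ : conjPowers (π (upper 1)) ∪ conjPowers (π (lower (d₁ ^ 2))) ⊆ unipotentClass 1 := by
    refine Set.union_subset (conjPowers_upper_subset fun n => ?_)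
      (conjPowers_lower_subset fun n => ?_) <;>
      obtain ⟨s, hs⟩ := isSquare_natCast hp hodd hK n
    · exact ⟨s, by rw [hs]; ring⟩
    · exact ⟨i * s * d₁, by rw [hs]; linear_combination s * s * d₁ ^ 2 * hi⟩
  have hsub₂ : conjPowers (π (upper ν)) ∪ conjPowers (π (lower (d₂ ^ 2 / ν))) ⊆
      unipotentClass ν := by
    refine Set.union_subset (conjPowers_upper_subset fun n => ?_)
      (conjPowers_lower_subset fun n => ?_) <;>
      obtain ⟨s, hs⟩ := isSquare_natCast hp hodd hK n
    · exact ⟨s, by rw [hs]; ring⟩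
    · refine ⟨i * s * d₂ / ν, ?_⟩
      rw [hs]
      field_simp
      linear_combination s ^ 2 * hi
  have hpQ : p ∣ Q := (dvd_pow_self p he.ne').trans (dvd_pow_self _ two_ne_zero)
  have hcop₁ : p.Coprime ((Q - 1) / 2) := by
    refine hp.coprime_iff_not_dvd.2 fun h => hp.one_lt.ne' (Nat.dvd_one.1 ?_)
    have := (Nat.dvd_sub hpQ (h.mul_left 2))
    rwa [show Q - 2 * ((Q - 1) / 2) = 1 by omega] at this
  have hcop₂ : p.Coprime ((Q + 1) / 2) := by
    refine hp.coprime_iff_not_dvd.2 fun h => hp.one_lt.ne' (Nat.dvd_one.1 ?_)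
    have := (Nat.dvd_sub (h.mul_left 2) hpQ)
    rwa [show 2 * ((Q + 1) / 2) - Q = 1 by omega] at this
  have hcop : ((Q - 1) / 2).Coprime ((Q + 1) / 2) := by
    rw [show (Q + 1) / 2 = (Q - 1) / 2 + 1 by omega]
    exact (Nat.coprime_self_add_right).2 (Nat.coprime_one_right _)
  refine ⟨_, _, orderOf_dvd_of_pow_eq_one hc₁, orderOf_dvd_of_pow_eq_one hc₂, π (upper 1),
    π (lower (d₁ ^ 2)), (π (upper 1 * lower (d₁ ^ 2)))⁻¹, π (upper ν), π (lower (d₂ ^ 2 / ν)),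
    (π (upper ν * lower (d₂ ^ 2 / ν)))⁻¹, ⟨mul_inv_cancel _, mul_inv_cancel _,
    closure_mk_eq_top _ htop₁, closure_mk_eq_top _ htop₂, ?_⟩,
    orderOf_mk_of_pow_eq_one hp (upper_pow_char p _) (upper_notMem_center one_ne_zero),
    orderOf_mk_of_pow_eq_one hp (lower_pow_char p _) (lower_notMem_center hdd₁), rfl,
    orderOf_mk_of_pow_eq_one hp (upper_pow_char p _) (upper_notMem_center hν0),
    orderOf_mk_of_pow_eq_one hp (lower_pow_char p _) (lower_notMem_center hdd₂), rfl⟩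
  refine Set.Subset.antisymm ?_ (Set.singleton_subset_iff.2
    ⟨one_mem_sigma3 _ _ _, one_mem_sigma3 _ _ _⟩)
  rintro x ⟨hx₁ | hx₁, hx₂ | hx₂⟩
  · exact unipotentClass_inter h2 hν ⟨hsub₁ hx₁, hsub₂ hx₂⟩
  · exact eq_one_of_pow_of_coprime hcop₂ (unipotentClass_pow p (hsub₁ hx₁))
      (pow_eq_one_of_mem_conjPowers hx₂ hc₂)
  · exact eq_one_of_pow_of_coprime hcop₁ (unipotentClass_pow p (hsub₂ hx₂))
      (pow_eq_one_of_mem_conjPowers hx₁ hc₁)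
  · exact eq_one_of_pow_of_coprime hcop (pow_eq_one_of_mem_conjPowers hx₁ hc₁)
      (pow_eq_one_of_mem_conjPowers hx₂ hc₂)
end
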